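/- For every nonempty bounded open set A ⊂ ℝ^d and every q > 0, the limiting derivative martingale measure possesses negative moments: E[M'(A)^{−q}] < ∞, where M'(A) is the almost sure limit as t → ∞ of M'_t(A) = ∫_A (√(2d)·t − X_t(x)) e^{√(2d)·X_t(x) − d·t} dx (which is strictly positive almost surely). -/

import Mathlib

open MeasureTheory ProbabilityTheory Filter

noncomputable section

namespace DerivMeas

/-- Standard Gaussian measure. -/
abbrev N01 : Measure ℝ := gaussianReal 0 1

lemma tilt_lintegral (γ y : ℝ) (φ : ℝ → ENNReal) (hφ : Measurable φ) :
    ∫⁻ ξ, ENNReal.ofReal (Real.exp (γ * ξ - γ ^ 2 / 2)) * φ (y + γ - ξ) ∂N01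
      = ∫⁻ z, φ (y + z) ∂N01 := by
  have h1 : (1 : NNReal) ≠ 0 := one_ne_zero
  rw [N01, gaussianReal_of_var_ne_zero _ h1,
    lintegral_withDensity_eq_lintegral_mul _ (measurable_gaussianPDF 0 1) (by fun_prop),
    lintegral_withDensity_eq_lintegral_mul _ (measurable_gaussianPDF 0 1) (by fun_prop),
    ← lintegral_sub_left_eq_self _ γ]
  apply lintegral_congr
  intro ξ
  simp only [Pi.mul_apply, gaussianPDF]
  rw [← mul_assoc, ← ENNReal.ofReal_mul (gaussianPDFReal_nonneg _ _ _)]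
  congr 2
  · simp only [gaussianPDFReal]
    rw [mul_assoc, ← Real.exp_add]
    congr 2
    simp
    ring
  · ring_nf

lemma exp_lintegral (t : ℝ) (v : NNReal) :
    ∫⁻ z, ENNReal.ofReal (Real.exp (t * z)) ∂(gaussianReal 0 v)
      = ENNReal.ofReal (Real.exp (v * t ^ 2 / 2)) := by
  rw [← ofReal_integral_eq_lintegral_ofReal (integrable_exp_mul_gaussianReal t)
    (ae_of_all _ fun _ => (Real.exp_pos _).le)]
  congr 1
  have := mgf_gaussianReal (p := gaussianReal 0 v) (X := id) (μ := 0) (v := v) (by simp) t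
  simpa [mgf] using this

/-- Killed Gaussian random walk operator. -/
def PK (φ : ℝ → ENNReal) (y : ℝ) : ENNReal :=
  ∫⁻ z, (if 0 < y + z then φ (y + z) else 0) ∂N01

lemma measurable_PK {φ : ℝ → ENNReal} (hφ : Measurable φ) : Measurable (PK φ) := by
  unfold PK
  have : Measurable fun p : ℝ × ℝ => (if 0 < p.1 + p.2 then φ (p.1 + p.2) else 0) := by
    refine Measurable.ite (measurableSet_lt measurable_const (by fun_prop)) (by fun_prop) (by fun_prop)
  exact this.lintegral_prod_right'

lemma PK_mono {φ ψ : ℝ → ENNReal} (h : ∀ y, 0 < y → φ y ≤ ψ y) (y : ℝ) : PK φ y ≤ PK ψ y := by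
  unfold PK
  apply lintegral_mono
  intro z
  dsimp only
  split_ifs with hz
  · exact h _ hz
  · exact le_rfl

lemma PK_add {φ ψ : ℝ → ENNReal} (h : Measurable φ) (y : ℝ) :
    PK (fun y => φ y + ψ y) y = PK φ y + PK ψ y := by
  unfold PK
  rw [← lintegral_add_left]
  · apply lintegral_congr
    intro z
    split_ifs <;> simp
  · exact Measurable.ite (measurableSet_lt measurable_const (by fun_prop)) (by fun_prop) (by fun_prop)

lemma measurable_PKit {φ : ℝ → ENNReal} (hφ : Measurable φ) (n : ℕ) : Measurable (PK^[n] φ) := by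
  induction n generalizing φ with
  | zero => exact hφ
  | succ n ih => exact ih (measurable_PK hφ)

lemma PKit_mono {φ ψ : ℝ → ENNReal} (h : ∀ y, 0 ≤ y → φ y ≤ ψ y) (n : ℕ) :
    ∀ y, 0 ≤ y → (PK^[n] φ) y ≤ (PK^[n] ψ) y := by
  induction n generalizing φ ψ with
  | zero => exact h
  | succ n ih => exact ih (fun y _ => PK_mono (fun z hz => h z hz.le) y)

lemma PK_sub (y : ℝ) : ENNReal.ofReal y ≤ PK (fun z => ENNReal.ofReal z) y := by
  have hyInt : Integrable (fun z : ℝ => y + z) N01 :=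
    (integrable_const y).add (by simpa using! (memLp_id_gaussianReal (μ := 0) (v := 1) 1).integrable (by simp))
  have h1 : ∫ z, (y + z) ∂N01 = y := by
    rw [integral_add (integrable_const y) (by simpa using! (memLp_id_gaussianReal (μ := 0) (v := 1) 1).integrable (by simp))]
    simp [N01]
  calc ENNReal.ofReal y = ENNReal.ofReal (∫ z, (y + z) ∂N01) := by rw [h1]
    _ ≤ ∫⁻ z, ENNReal.ofReal (y + z) ∂N01 := by
        refine (ENNReal.ofReal_le_ofReal (integral_mono hyInt hyInt.pos_part
          (fun z => le_max_left _ _))).trans ?_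
        rw [ofReal_integral_eq_lintegral_ofReal hyInt.pos_part (ae_of_all _ fun z => le_max_right _ _)]
        apply lintegral_mono
        intro z
        simp [ENNReal.ofReal_max]
    _ ≤ _ := by
        unfold PK
        apply lintegral_mono
        intro z
        dsimp only
        split_ifs with hz
        · exact le_rfl
        · simp [ENNReal.ofReal_of_nonpos (not_lt.1 hz)]

/-- The constant `E[N^+]`. -/
def c0 : ENNReal := PK (fun z => ENNReal.ofReal z) 0

lemma c0_pos : 0 < c0 := by
  unfold c0 PK
  rw [lintegral_pos_iff_support
    (Measurable.ite (measurableSet_lt measurable_const (by fun_prop)) (by fun_prop) (by fun_prop))]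
  have : Set.Ioi (0:ℝ) ⊆ Function.support fun z : ℝ => (if 0 < 0 + z then ENNReal.ofReal (0 + z) else 0) := by
    intro z hz
    simp only [Set.mem_Ioi] at hz
    simp [hz]
  refine lt_of_lt_of_le ?_ (measure_mono this)
  have hac := gaussianReal_absolutelyContinuous' 0 (v := 1) one_ne_zero
  by_contra hcon
  have := hac (le_antisymm (not_lt.1 hcon) (zero_le))
  simp at this

lemma PKit_lower (n : ℕ) : c0 ≤ (PK^[n + 1] (fun z => ENNReal.ofReal z)) 0 := by
  induction n with
  | zero => exact le_rfl
  | succ n ih =>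
    refine ih.trans ?_
    rw [Function.iterate_succ_apply PK (n + 1)]
    exact PKit_mono (fun y _ => PK_sub y) _ 0 le_rfl

/-- Supersolution. -/
lemma exists_super (γ : ℝ) (hγ : 0 < γ) : ∃ (G : ℝ → ℝ) (δ C : ℝ), 0 < δ ∧ 0 < C ∧ Measurable G ∧
    (∀ y, 0 ≤ y → y ≤ G y) ∧
    (∀ y, 0 ≤ y → PK (fun z => ENNReal.ofReal (G z)) y
        + ENNReal.ofReal (δ * Real.exp (-(γ / 2) * y)) ≤ ENNReal.ofReal (G y)) ∧
    (∀ y, 0 ≤ y → Real.exp (-γ * y) * (G y) ^ 2 ≤ C * Real.exp (-(γ / 2) * y)) := by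
  set c := γ / 2 with hc
  have hcpos : 0 < c := by positivity
  set e1 := Real.exp (c ^ 2 / 2) with he1
  set e2 := Real.exp (2 * c ^ 2) with he2
  have he1' : 1 < e1 := by rw [he1]; exact Real.one_lt_exp_iff.2 (by positivity)
  have he2' : 0 < e2 := Real.exp_pos _
  set δ := (e1 - 1) / 2 with hδ
  have hδpos : 0 < δ := by rw [hδ]; linarith
  -- choose L
  set B := (1 + 1 / c) ^ 2 * e2 / (4 * δ) with hB
  have hBpos : 0 < B := by positivity
  set L := B + 1 with hL
  have hL1 : 1 ≤ L := by linarith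
  set κ := (1 + 1 / c) ^ 2 / (4 * L) with hκ
  have hκpos : 0 < κ := by positivity
  have hκe : κ * e2 ≤ δ := by
    rw [hκ, div_mul_eq_mul_div, div_le_iff₀ (by positivity)]
    have : (1 + 1 / c) ^ 2 * e2 = B * (4 * δ) := by rw [hB]; field_simp
    rw [this]; nlinarith
  refine ⟨fun z => z + L - Real.exp (-c * z), δ, (4 / γ + L) ^ 2 * 1 + 1, hδpos, by positivity, by fun_prop,
    ?_, ?_, ?_⟩
  · intro y hy
    have : Real.exp (-c * y) ≤ 1 := Real.exp_le_one_iff.2 (by nlinarith)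
    linarith
  · intro y hy
    have hpt : ∀ z : ℝ, (if 0 < z then ENNReal.ofReal (z + L - Real.exp (-c * z)) else 0)
        ≤ ENNReal.ofReal (z + L - Real.exp (-c * z) + κ * Real.exp (-(2 * c) * z)) := by
      intro z
      split_ifs with hz
      · exact ENNReal.ofReal_le_ofReal (by linarith [mul_pos hκpos (Real.exp_pos (-(2 * c) * z))])
      · exact zero_le
    have hpos : ∀ z : ℝ, 0 ≤ z + L - Real.exp (-c * z) + κ * Real.exp (-(2 * c) * z) := by
      intro z
      set v := Real.exp (-c * z) with hv
      have hv2 : Real.exp (-(2 * c) * z) = v ^ 2 := by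
        rw [hv, ← Real.exp_nat_mul]; congr 1; push_cast; ring
      have hvz : -z ≤ v / c := by
        rw [le_div_iff₀ hcpos]
        have := Real.add_one_le_exp (-c * z)
        linarith
      rw [hv2]
      have : 0 ≤ L - (1 + 1 / c) * v + κ * v ^ 2 := by
        rw [hκ]
        have : L - (1 + 1 / c) * v + (1 + 1 / c) ^ 2 / (4 * L) * v ^ 2
          = (2 * L - (1 + 1 / c) * v) ^ 2 / (4 * L) := by field_simp; ring
        rw [this]; positivity
      have h3 : (1 + 1 / c) * v = v + v / c := by ring
      linarith
    have hyInt1 : Integrable (fun z : ℝ => z) N01 := by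
      simpa using! (memLp_id_gaussianReal (μ := 0) (v := 1) 1).integrable (by simp)
    have hexp : ∀ t : ℝ, Integrable (fun z : ℝ => Real.exp (t * z)) N01 :=
      fun t => integrable_exp_mul_gaussianReal t
    have hexpv : ∀ t : ℝ, ∫ z, Real.exp (t * z) ∂N01 = Real.exp (t ^ 2 / 2) := by
      intro t
      have := mgf_gaussianReal (p := gaussianReal 0 1) (X := id) (μ := 0) (v := 1) (by simp) t
      simpa [mgf] using this
    have hfun : (fun z : ℝ => (y + z) + L - Real.exp (-c * (y + z)) + κ * Real.exp (-(2 * c) * (y + z)))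
      = fun z : ℝ => (((y + L) + z) - Real.exp (-c * y) * Real.exp (-c * z))
          + (κ * Real.exp (-(2 * c) * y)) * Real.exp (-(2 * c) * z) := by
      funext z
      rw [mul_add, mul_add, Real.exp_add, Real.exp_add]; ring
    have i1 : Integrable (fun z : ℝ => (y + L) + z) N01 := (integrable_const _).add hyInt1
    have i2 := (hexp (-c)).const_mul (Real.exp (-c * y))
    have i3 := (hexp (-(2 * c))).const_mul (κ * Real.exp (-(2 * c) * y))
    have hI : Integrable (fun z : ℝ => (y + z) + L - Real.exp (-c * (y + z)) + κ * Real.exp (-(2 * c) * (y + z))) N01 := by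
      rw [hfun]; exact (i1.sub i2).add i3
    have hval : ∫ z, ((y + z) + L - Real.exp (-c * (y + z)) + κ * Real.exp (-(2 * c) * (y + z))) ∂N01
        = y + L - Real.exp (-c * y) * e1 + κ * Real.exp (-(2 * c) * y) * e2 := by
      rw [hfun, show ∫ z : ℝ, (((y + L) + z) - Real.exp (-c * y) * Real.exp (-c * z) + κ * Real.exp (-(2 * c) * y) * Real.exp (-(2 * c) * z)) ∂N01 = _ from integral_add (i1.sub i2) i3]
      rw [show ∫ z : ℝ, (((y + L) + z) - Real.exp (-c * y) * Real.exp (-c * z)) ∂N01 = _ from integral_sub i1 i2]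
      rw [integral_const_mul, integral_const_mul,
        hexpv, hexpv, integral_add (integrable_const _) hyInt1]
      have : ∫ z : ℝ, z ∂N01 = 0 := by simp [N01]
      rw [this, he1, he2]
      simp only [integral_const, probReal_univ, smul_eq_mul, one_mul, add_zero]
      congr 3
      · ring_nf
      · ring_nf
    have hle : PK (fun z => ENNReal.ofReal (z + L - Real.exp (-c * z))) y
        ≤ ENNReal.ofReal (y + L - Real.exp (-c * y) * e1 + κ * Real.exp (-(2 * c) * y) * e2) := by
      rw [← hval, ofReal_integral_eq_lintegral_ofReal hI (ae_of_all _ fun z => hpos _)]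
      exact lintegral_mono fun z => hpt (y + z)
    refine (add_le_add_left hle _).trans ?_
    have hnn : 0 ≤ y + L - Real.exp (-c * y) * e1 + κ * Real.exp (-(2 * c) * y) * e2 := by
      rw [← hval]; exact integral_nonneg fun z => hpos _
    rw [← ENNReal.ofReal_add hnn (by positivity)]
    apply ENNReal.ofReal_le_ofReal
    have hvle : Real.exp (-(2 * c) * y) ≤ Real.exp (-c * y) := Real.exp_le_exp.2 (by nlinarith)
    have hv := Real.exp_pos (-c * y)
    have h4 : κ * Real.exp (-(2 * c) * y) * e2 ≤ δ * Real.exp (-c * y) := by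
      calc κ * Real.exp (-(2 * c) * y) * e2 = (κ * e2) * Real.exp (-(2 * c) * y) := by ring
        _ ≤ δ * Real.exp (-c * y) := mul_le_mul hκe hvle (Real.exp_pos _).le hδpos.le
    have h5 : e1 = 2 * δ + 1 := by rw [hδ]; ring
    rw [h5]
    nlinarith
  · intro y hy
    have h1 : Real.exp (-c * y) ≤ 1 := Real.exp_le_one_iff.2 (by nlinarith)
    have h0 : 0 ≤ y + L - Real.exp (-c * y) := by linarith
    have h2 : y + L - Real.exp (-c * y) ≤ (4 / γ + L) * Real.exp (c / 2 * y) := by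
      have h3 := Real.add_one_le_exp (c / 2 * y)
      have h4 : (1:ℝ) ≤ Real.exp (c / 2 * y) := Real.one_le_exp (by positivity)
      have h5 : y ≤ 4 / γ * Real.exp (c / 2 * y) := by
        have : y = 4 / γ * (c / 2 * y) := by rw [hc]; field_simp; ring
        calc y = 4 / γ * (c / 2 * y) := this
          _ ≤ _ := by gcongr; linarith
      nlinarith [Real.exp_pos (-c * y)]
    have h3 : (y + L - Real.exp (-c * y)) ^ 2 ≤ (4 / γ + L) ^ 2 * Real.exp (c * y) := by
      calc _ ≤ ((4 / γ + L) * Real.exp (c / 2 * y)) ^ 2 := by gcongr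
        _ = _ := by rw [mul_pow, ← Real.exp_nat_mul]; congr 2; push_cast; ring
    calc Real.exp (-γ * y) * (y + L - Real.exp (-c * y)) ^ 2
        ≤ Real.exp (-γ * y) * ((4 / γ + L) ^ 2 * Real.exp (c * y)) := by gcongr
      _ = (4 / γ + L) ^ 2 * Real.exp (-c * y) := by
          rw [mul_left_comm, ← Real.exp_add]; congr 2; rw [hc]; ring
      _ ≤ _ := by gcongr; linarith

lemma green_bound {G : ℝ → ℝ} {δ c : ℝ} (hG : Measurable G)
    (h : ∀ y, 0 ≤ y → PK (fun z => ENNReal.ofReal (G z)) y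
        + ENNReal.ofReal (δ * Real.exp (-c * y)) ≤ ENNReal.ofReal (G y)) (n : ℕ) :
    ∑ m ∈ Finset.range n, (PK^[m] (fun y => ENNReal.ofReal (δ * Real.exp (-c * y)))) 0
      + (PK^[n] (fun z => ENNReal.ofReal (G z))) 0 ≤ ENNReal.ofReal (G 0) := by
  have padd : ∀ (n : ℕ) (φ ψ : ℝ → ENNReal), Measurable φ →
      PK^[n] (fun y => φ y + ψ y) = fun y => (PK^[n] φ) y + (PK^[n] ψ) y := by
    intro n
    induction n with
    | zero => intro φ ψ _; rfl
    | succ n ih =>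
      intro φ ψ hφ
      rw [Function.iterate_succ_apply, Function.iterate_succ_apply, Function.iterate_succ_apply]
      have : PK (fun y => φ y + ψ y) = fun y => PK φ y + PK ψ y := funext fun y => PK_add hφ y
      rw [this, ih _ _ (measurable_PK hφ)]
  induction n with
  | zero => simp
  | succ n ih =>
    refine le_trans ?_ ih
    rw [Finset.sum_range_succ, add_assoc]
    gcongr
    rw [Function.iterate_succ_apply PK n, add_comm]
    have := PKit_mono h n 0 le_rfl
    rw [padd n _ _ (measurable_PK (by fun_prop))] at this
    exact this

end DerivMeas

namespace DerivMeas

abbrev E (d : ℕ) := EuclideanSpace ℝ (Fin d)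

/-- The discrete-time field with all the properties we use. -/
structure CritField {d : ℕ} {Ω : Type*} [MeasurableSpace Ω] (P : Measure Ω)
    (W : ℕ → E d → Ω → ℝ) (K : ℕ → E d → ℝ) (R L : ℝ) : Prop where
  meas : ∀ n x, Measurable (W n x)
  cont : ∀ n ω, Continuous fun x => W n x ω
  gauss : IsGaussianProcess (fun p : ℕ × E d => W p.1 p.2) P
  cent : ∀ n x, ∫ ω, W n x ω ∂P = 0
  cov : ∀ m n x y, ∫ ω, W m x ω * W n y ω ∂P = K (min m n) (x - y)
  zero : ∀ x ω, W 0 x ω = 0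
  K0 : ∀ n, K n 0 = n
  Ksep : ∀ (m n : ℕ) (z : E d), m ≤ n → R * Real.exp (-(m:ℝ)) ≤ ‖z‖ → K n z = K m z
  Kclose : ∀ (n : ℕ) (z : E d), (n:ℝ) - K n z ≤ L * ‖z‖ * Real.exp n
  R2 : 2 ≤ R
  L0 : 0 ≤ L

variable {d : ℕ} {Ω : Type*} [m0 : MeasurableSpace Ω] {P : Measure Ω}
    {W : ℕ → E d → Ω → ℝ} {K : ℕ → E d → ℝ} {R L : ℝ}

/-- Time increments. -/
def inc (W : ℕ → E d → Ω → ℝ) (p : ℕ × ℕ × E d) (ω : Ω) : ℝ := W p.1 p.2.2 ω - W p.2.1 p.2.2 ω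

def covK (K : ℕ → E d → ℝ) (p q : ℕ × ℕ × E d) : ℝ :=
  K (min p.1 q.1) (p.2.2 - q.2.2) - K (min p.1 q.2.1) (p.2.2 - q.2.2)
    - K (min p.2.1 q.1) (p.2.2 - q.2.2) + K (min p.2.1 q.2.1) (p.2.2 - q.2.2)

set_option linter.unusedSectionVars false

/-- sigma-algebra generated by a family of increments. -/
@[reducible] def sig (W : ℕ → E d → Ω → ℝ) (I : Set (ℕ × ℕ × E d)) : MeasurableSpace Ω :=
  MeasurableSpace.comap (fun ω (s : I) => inc W s ω) inferInstance

lemma measurable_inc (h : CritField P W K R L) (p : ℕ × ℕ × E d) : Measurable (inc W p) :=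
  (h.meas _ _).sub (h.meas _ _)

lemma sig_le (h : CritField P W K R L) (I : Set (ℕ × ℕ × E d)) : sig W I ≤ m0 := by
  rw [sig, ← measurable_iff_comap_le]
  exact measurable_pi_lambda _ fun s => measurable_inc h s

lemma inc_meas_sig (I : Set (ℕ × ℕ × E d)) {p : ℕ × ℕ × E d} (hp : p ∈ I) :
    Measurable[sig W I] (inc W p) := by
  have h1 : Measurable[sig W I] (fun ω (s : I) => inc W s ω) := comap_measurable _
  exact (measurable_pi_apply (⟨p, hp⟩ : I)).comp h1

lemma gauss_inc (h : CritField P W K R L) : IsGaussianProcess (inc W) P := by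
  classical
  refine IsGaussianProcess.of_isGaussianProcess h.gauss fun p => ⟨{(p.1, p.2.2), (p.2.1, p.2.2)},
    { toFun x := x ⟨(p.1, p.2.2), by simp⟩ - x ⟨(p.2.1, p.2.2), by simp⟩
      map_add' x y := by simp; abel
      map_smul' c x := by simp; ring },
    fun ω => by simp [inc]⟩

lemma memLp_W (h : CritField P W K R L) (n : ℕ) (x : E d) : MemLp (W n x) 2 P :=
  (h.gauss.hasGaussianLaw_eval (n, x)).memLp_two

lemma cov_W (h : CritField P W K R L) (m n : ℕ) (x y : E d) :
    cov[W m x, W n y; P] = K (min m n) (x - y) := by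
  have := h.gauss.isProbabilityMeasure
  rw [covariance_eq_sub (memLp_W h m x) (memLp_W h n y), h.cent, h.cent, ← h.cov m n x y]
  simp

lemma cov_inc (h : CritField P W K R L) (p q : ℕ × ℕ × E d) :
    cov[inc W p, inc W q; P] = covK K p q := by
  have := h.gauss.isProbabilityMeasure
  have e1 : ∀ p : ℕ × ℕ × E d, inc W p = W p.1 p.2.2 - W p.2.1 p.2.2 := fun p => rfl
  rw [e1 p, e1 q, covariance_sub_left (memLp_W h _ _) (memLp_W h _ _)
      ((memLp_W h _ _).sub (memLp_W h _ _)),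
    covariance_sub_right (memLp_W h _ _) (memLp_W h _ _) (memLp_W h _ _),
    covariance_sub_right (memLp_W h _ _) (memLp_W h _ _) (memLp_W h _ _)]
  simp only [cov_W h, covK]
  ring

lemma indep_sig (h : CritField P W K R L) {I J : Set (ℕ × ℕ × E d)}
    (hIJ : ∀ p ∈ I, ∀ q ∈ J, covK K p q = 0) : Indep (sig W I) (sig W J) P := by
  have : IsGaussianProcess (Sum.elim (fun s : I => inc W s) (fun s : J => inc W s)) P := by
    have := (gauss_inc h).comp_right (Sum.elim (fun s : I => (s : ℕ × ℕ × E d)) (fun s : J => (s : ℕ × ℕ × E d)))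
    convert! this using 1
    funext s; cases s <;> rfl
  have h2 := this.indepFun_of_covariance_eq_zero (fun s => (measurable_inc h _).aemeasurable)
    (fun s => (measurable_inc h _).aemeasurable) (fun s t => by rw [cov_inc h]; exact hIJ _ s.2 _ t.2)
  exact h2

lemma iIndep_sig (h : CritField P W K R L) {ι : Type*} {I : ι → Set (ℕ × ℕ × E d)}
    (hI : ∀ i j, i ≠ j → ∀ p ∈ I i, ∀ q ∈ I j, covK K p q = 0) :
    iIndep (fun i => sig W (I i)) P := by
  have : IsGaussianProcess (fun (p : (i : ι) × I i) ω => inc W (p.2 : ℕ × ℕ × E d) ω) P :=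
    (gauss_inc h).comp_right (fun p : (i : ι) × I i => (p.2 : ℕ × ℕ × E d))
  have h2 := IsGaussianProcess.iIndepFun_of_covariance_eq_zero (X := fun i (s : I i) => inc W s)
    this (fun i s => (measurable_inc h _).aemeasurable)
    (fun i j hij s t => by rw [cov_inc h]; exact hI i j hij _ s.2 _ t.2)
  exact h2

lemma law_inc (h : CritField P W K R L) (p : ℕ × ℕ × E d) :
    P.map (inc W p) = gaussianReal 0 (covK K p p).toNNReal := by
  have := h.gauss.isProbabilityMeasure
  rw [((gauss_inc h).hasGaussianLaw_eval p).map_eq_gaussianReal, ← covariance_self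
    (measurable_inc h p).aemeasurable, cov_inc h]
  congr 1
  change ∫ ω, (W p.1 p.2.2 ω - W p.2.1 p.2.2 ω) ∂P = 0
  rw [integral_sub ((memLp_W h _ _).integrable (by norm_num)) ((memLp_W h _ _).integrable (by norm_num)),
    h.cent, h.cent, sub_zero]

lemma law_step (h : CritField P W K R L) (n : ℕ) (x : E d) :
    P.map (inc W (n + 1, n, x)) = N01 := by
  rw [law_inc h]
  congr 1
  simp [covK, h.K0]

lemma tilt_step {Ω : Type*} {m m0 : MeasurableSpace Ω} {P : Measure Ω} [IsProbabilityMeasure P] (hm : m ≤ m0) {ξ : Ω → ℝ} (hξ : Measurable ξ)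
    (hind : Indep m (MeasurableSpace.comap ξ inferInstance) P) (hlaw : P.map ξ = N01)
    {A : Ω → ENNReal} (hA : Measurable[m] A) {Y : Ω → ℝ} (hY : Measurable[m] Y) (γ : ℝ)
    {φ : ℝ → ENNReal} (hφ : Measurable φ) :
    ∫⁻ ω, A ω * (ENNReal.ofReal (Real.exp (γ * ξ ω - γ ^ 2 / 2)) * φ (Y ω + γ - ξ ω)) ∂P
      = ∫⁻ ω, A ω * ∫⁻ z, φ (Y ω + z) ∂N01 ∂P := by
  have hA' : Measurable A := hA.mono hm le_rfl
  have hY' : Measurable Y := hY.mono hm le_rfl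
  have hpair : IndepFun (fun ω => (A ω, Y ω)) ξ P := by
    refine indep_of_indep_of_le_left hind ?_
    rw [← measurable_iff_comap_le]
    exact hA.prodMk hY
  have hprod := (indepFun_iff_map_prod_eq_prod_map_map (hA'.prodMk hY').aemeasurable hξ.aemeasurable).1 hpair
  have e1 : ∫⁻ ω, A ω * (ENNReal.ofReal (Real.exp (γ * ξ ω - γ ^ 2 / 2)) * φ (Y ω + γ - ξ ω)) ∂P
      = ∫⁻ p : (ENNReal × ℝ) × ℝ, p.1.1 * (ENNReal.ofReal (Real.exp (γ * p.2 - γ ^ 2 / 2)) * φ (p.1.2 + γ - p.2))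
        ∂(P.map (fun ω => ((A ω, Y ω), ξ ω))) := by
    rw [lintegral_map (by fun_prop) (by fun_prop)]
  rw [e1, hprod, lintegral_prod _ (by fun_prop), hlaw]
  have e2 : ∀ p : ENNReal × ℝ, ∫⁻ t, p.1 * (ENNReal.ofReal (Real.exp (γ * t - γ ^ 2 / 2)) * φ (p.2 + γ - t)) ∂N01
      = p.1 * ∫⁻ z, φ (p.2 + z) ∂N01 := by
    intro p
    rw [lintegral_const_mul _ (by fun_prop), tilt_lintegral γ p.2 φ hφ]
  simp only [e2]
  have hm2 : Measurable fun p : ENNReal × ℝ => p.1 * ∫⁻ z, φ (p.2 + z) ∂N01 := by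
    refine measurable_fst.mul ?_
    have : Measurable fun q : (ENNReal × ℝ) × ℝ => φ (q.1.2 + q.2) := by fun_prop
    exact this.lintegral_prod_right'
  rw [lintegral_map hm2 (by fun_prop)]

/-- `S_j(x) = γ j - (X_{T+j}(x) - X_T(x))`. -/
def S (γ : ℝ) (W : ℕ → E d → Ω → ℝ) (T j : ℕ) (x : E d) (ω : Ω) : ℝ := γ * j - inc W (T + j, T, x) ω

/-- Killed exponential weight. -/
def V (γ : ℝ) (W : ℕ → E d → Ω → ℝ) (T : ℕ) : ℕ → E d → Ω → ENNReal
  | 0, _, _ => 1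
  | j + 1, x, ω => V γ W T j x ω *
      (ENNReal.ofReal (Real.exp (γ * inc W (T + j + 1, T + j, x) ω - γ ^ 2 / 2)) *
        (if 0 < S γ W T (j + 1) x ω then 1 else 0))

lemma S_zero (γ : ℝ) (T : ℕ) (x : E d) (ω : Ω) : S γ W T 0 x ω = 0 := by simp [S, inc]

lemma S_succ (γ : ℝ) (T j : ℕ) (x : E d) (ω : Ω) :
    S γ W T (j + 1) x ω = S γ W T j x ω + γ - inc W (T + j + 1, T + j, x) ω := by
  simp only [S, inc]; push_cast; rw [← add_assoc]; ring

lemma S_meas_sig {I : Set (ℕ × ℕ × E d)} (γ : ℝ) (T j : ℕ) (x : E d) (hI : (T + j, T, x) ∈ I) :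
    Measurable[sig W I] (S γ W T j x) := (inc_meas_sig I hI).const_sub _

lemma inc_step_meas_sig {I : Set (ℕ × ℕ × E d)} (T j : ℕ) (x : E d) (hI : (T + j, T, x) ∈ I)
    (hI' : (T + j + 1, T, x) ∈ I) : Measurable[sig W I] (inc W (T + j + 1, T + j, x)) := by
  have : inc W (T + j + 1, T + j, x) = fun ω => inc W (T + j + 1, T, x) ω - inc W (T + j, T, x) ω := by
    funext ω; simp [inc]
  rw [this]
  exact (inc_meas_sig I hI').sub (inc_meas_sig I hI)

lemma V_meas_sig {I : Set (ℕ × ℕ × E d)} (γ : ℝ) (T j : ℕ) (x : E d)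
    (hI : ∀ i, i ≤ j → (T + i, T, x) ∈ I) : Measurable[sig W I] (V γ W T j x) := by
  induction j with
  | zero => exact measurable_const
  | succ j ih =>
    refine (ih fun i hi => hI i (by omega)).mul (Measurable.mul ?_ ?_)
    · have := inc_step_meas_sig (W := W) T j x (hI j (by omega)) (hI (j + 1) le_rfl)
      exact ENNReal.measurable_ofReal.comp (Real.measurable_exp.comp ((this.const_mul γ).sub_const _))
    · exact Measurable.ite (measurableSet_lt measurable_const
        (S_meas_sig γ T (j + 1) x (hI (j + 1) le_rfl))) measurable_const measurable_const

lemma S_nonneg_of_V {γ : ℝ} {T j : ℕ} {x : E d} {ω : Ω} (h : V γ W T j x ω ≠ 0) :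
    0 ≤ S γ W T j x ω := by
  cases j with
  | zero => rw [S_zero]
  | succ j =>
    by_contra hcon
    apply h
    simp [V, not_lt.2 (not_le.1 hcon).le]

lemma V_sq (γ : ℝ) (T j : ℕ) (x : E d) (ω : Ω) :
    V γ W T j x ω * V γ W T j x ω = V γ W T j x ω *
      ENNReal.ofReal (Real.exp (γ * inc W (T + j, T, x) ω - γ ^ 2 / 2 * j)) := by
  induction j with
  | zero => simp [V, inc]
  | succ j ih =>
    have e : Real.exp (γ * inc W (T + (j + 1), T, x) ω - γ ^ 2 / 2 * ((j + 1 : ℕ) : ℝ))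
      = Real.exp (γ * inc W (T + j, T, x) ω - γ ^ 2 / 2 * j)
        * Real.exp (γ * inc W (T + j + 1, T + j, x) ω - γ ^ 2 / 2) := by
      rw [← Real.exp_add]; congr 1; simp only [inc]; push_cast; rw [← add_assoc]; ring
    rw [e, ENNReal.ofReal_mul (Real.exp_pos _).le]
    simp only [V]
    split_ifs
    · rw [mul_one, mul_mul_mul_comm, ih]; ring
    · simp

lemma V_le (γ : ℝ) (T j : ℕ) (x : E d) (ω : Ω) : V γ W T j x ω ≤
      ENNReal.ofReal (Real.exp (γ * inc W (T + j, T, x) ω - γ ^ 2 / 2 * j)) := by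
  induction j with
  | zero => simp [V, inc]
  | succ j ih =>
    have e : Real.exp (γ * inc W (T + (j + 1), T, x) ω - γ ^ 2 / 2 * ((j + 1 : ℕ) : ℝ))
      = Real.exp (γ * inc W (T + j, T, x) ω - γ ^ 2 / 2 * j)
        * Real.exp (γ * inc W (T + j + 1, T + j, x) ω - γ ^ 2 / 2) := by
      rw [← Real.exp_add]; congr 1; simp only [inc]; push_cast; rw [← add_assoc]; ring
    rw [e, ENNReal.ofReal_mul (Real.exp_pos _).le]
    simp only [V]
    split_ifs
    · rw [mul_one]; gcongr
    · simp

lemma step_one [IsProbabilityMeasure P] (h : CritField P W K R L) (γ : ℝ) (T j : ℕ) (x : E d)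
    {I : Set (ℕ × ℕ × E d)} (hI : ∀ i, i ≤ j → (T + i, T, x) ∈ I)
    (hcov : ∀ p ∈ I, covK K p (T + j + 1, T + j, x) = 0)
    {B : Ω → ENNReal} (hB : Measurable[sig W I] B) {φ : ℝ → ENNReal} (hφ : Measurable φ) :
    ∫⁻ ω, B ω * (V γ W T (j + 1) x ω * φ (S γ W T (j + 1) x ω)) ∂P
      = ∫⁻ ω, B ω * (V γ W T j x ω * PK φ (S γ W T j x ω)) ∂P := by
  have hind : Indep (sig W I) (MeasurableSpace.comap (inc W (T + j + 1, T + j, x)) inferInstance) P := by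
    have h1 := indep_sig h (I := I) (J := {(T + j + 1, T + j, x)}) (fun p hp q hq => by
      rw [Set.mem_singleton_iff.1 hq]; exact hcov p hp)
    refine indep_of_indep_of_le_right h1 ?_
    exact (inc_meas_sig _ (Set.mem_singleton _)).comap_le
  have hψ : Measurable fun z : ℝ => if 0 < z then φ z else 0 :=
    Measurable.ite (measurableSet_lt measurable_const measurable_id) hφ measurable_const
  have key := tilt_step (sig_le h I) (measurable_inc h (T + j + 1, T + j, x)) hind (law_step h _ _)
    (A := fun ω => B ω * V γ W T j x ω) (hB.mul (V_meas_sig γ T j x hI))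
    (Y := S γ W T j x) (S_meas_sig γ T j x (hI j le_rfl)) γ hψ
  simp only [← S_succ] at key
  simp only [PK, ← mul_assoc] at key ⊢
  rw [← key]
  apply lintegral_congr
  intro ω
  simp only [V]
  split_ifs <;> ring

lemma one_point [IsProbabilityMeasure P] (h : CritField P W K R L) (γ : ℝ) (T j : ℕ) (x : E d)
    {φ : ℝ → ENNReal} (hφ : Measurable φ) :
    ∫⁻ ω, V γ W T j x ω * φ (S γ W T j x ω) ∂P = (PK^[j] φ) 0 := by
  induction j generalizing φ with
  | zero => simp [V, S_zero]
  | succ j ih =>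
    rw [Function.iterate_succ_apply, ← ih (measurable_PK hφ)]
    have := step_one h γ T j x (I := {p | ∃ i ≤ j, p = (T + i, T, x)}) (fun i hi => ⟨i, hi, rfl⟩)
      (by
        rintro p ⟨i, hi, rfl⟩
        simp only [covK]
        rw [show min (T + i) (T + j + 1) = T + i by omega, show min (T + i) (T + j) = T + i by omega,
          show min T (T + j + 1) = T by omega, show min T (T + j) = T by omega]
        ring) (B := fun _ => 1) measurable_const hφ
    simpa using this

lemma two_step [IsProbabilityMeasure P] (h : CritField P W K R L) (γ : ℝ) (T j : ℕ) (x y : E d)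
    (hxy : R * Real.exp (-((T + j : ℕ) : ℝ)) ≤ ‖x - y‖)
    {φ : ℝ → ENNReal} (hφ : Measurable φ) :
    ∫⁻ ω, (V γ W T (j + 1) y ω * φ (S γ W T (j + 1) y ω)) *
        (V γ W T (j + 1) x ω * φ (S γ W T (j + 1) x ω)) ∂P
      = ∫⁻ ω, (V γ W T j y ω * PK φ (S γ W T j y ω)) * (V γ W T j x ω * PK φ (S γ W T j x ω)) ∂P := by
  have hc : ∀ i ≤ j, ∀ z w : E d, covK K (T + i, T, z) (T + j + 1, T + j, w) = 0 := by
    intro i hi z w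
    simp only [covK]
    rw [show min (T + i) (T + j + 1) = T + i by omega, show min (T + i) (T + j) = T + i by omega,
      show min T (T + j + 1) = T by omega, show min T (T + j) = T by omega]
    ring
  have hc2 : covK K (T + j + 1, T, y) (T + j + 1, T + j, x) = 0 := by
    simp only [covK]
    rw [min_self, show min (T + j + 1) (T + j) = T + j by omega,
      show min T (T + j + 1) = T by omega, show min T (T + j) = T by omega,
      h.Ksep (T + j) (T + j + 1) (y - x) (by omega) (by rw [norm_sub_rev]; exact hxy)]
    ring
  set I1 : Set (ℕ × ℕ × E d) := {p | (∃ i ≤ j, ∃ z, p = (T + i, T, z)) ∨ p = (T + j + 1, T, y)} with hI1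
  set I2 : Set (ℕ × ℕ × E d) := {p | ∃ i ≤ j, ∃ z, p = (T + i, T, z)} with hI2
  have hy1 : ∀ i, i ≤ j + 1 → (T + i, T, y) ∈ I1 := by
    intro i hi
    rcases Nat.lt_or_ge j i with hlt | hle
    · right; obtain rfl : i = j + 1 := by omega
      rfl
    · left; exact ⟨i, hle, y, rfl⟩
  rw [step_one h γ T j x (I := I1) (fun i hi => Or.inl ⟨i, hi, x, rfl⟩) ?_
    (B := fun ω => V γ W T (j + 1) y ω * φ (S γ W T (j + 1) y ω)) ?_ hφ]
  · have := step_one h γ T j y (I := I2) (fun i hi => ⟨i, hi, y, rfl⟩) ?_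
      (B := fun ω => V γ W T j x ω * PK φ (S γ W T j x ω)) ?_ hφ
    · simp only [mul_comm (V γ W T j x _ * PK φ (S γ W T j x _))] at this
      exact this
    · rintro p ⟨i, hi, z, rfl⟩; exact hc i hi z y
    · exact (V_meas_sig (I := I2) γ T j x (fun i hi => ⟨i, hi, x, rfl⟩)).mul
        ((measurable_PK hφ).comp (S_meas_sig (I := I2) γ T j x ⟨j, le_rfl, x, rfl⟩))
  · rintro p (⟨i, hi, z, rfl⟩ | rfl)
    · exact hc i hi z x
    · exact hc2
  · exact (V_meas_sig γ T (j + 1) y hy1).mul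
      (hφ.comp (S_meas_sig γ T (j + 1) y (hy1 (j + 1) le_rfl)))

end DerivMeas

namespace DerivMeas

set_option linter.unusedSectionVars false
set_option linter.unusedVariables false

/-- integrand `V_n * S_n^+`. -/
def Wt {d : ℕ} {Ω : Type*} (γ : ℝ) (W : ℕ → E d → Ω → ℝ) (T n : ℕ) (x : E d) (ω : Ω) : ENNReal :=
  V γ W T n x ω * ENNReal.ofReal (S γ W T n x ω)

def Z {d : ℕ} {Ω : Type*} (γ : ℝ) (W : ℕ → E d → Ω → ℝ) (T n : ℕ) (B : Set (E d)) (ω : Ω) : ENNReal :=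
  ∫⁻ x in B, Wt γ W T n x ω

section joint
variable {d : ℕ} {Ω : Type*} [MeasurableSpace Ω] {W : ℕ → E d → Ω → ℝ}
  {ι : Type*} [TopologicalSpace ι] [TopologicalSpace.MetrizableSpace ι] [MeasurableSpace ι]
  [SecondCountableTopology ι] [OpensMeasurableSpace ι]

lemma inc_joint (hc : ∀ n ω, Continuous fun x => W n x ω) (e : ι → E d) (he : Continuous e)
    (a b : ℕ) (hm : ∀ z, Measurable (inc W (a, b, e z))) :
    Measurable fun p : ι × Ω => inc W (a, b, e p.1) p.2 :=
  measurable_uncurry_of_continuous_of_measurable (u := fun (z : ι) ω => inc W (a, b, e z) ω)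
    (fun ω => ((hc a ω).comp he).sub ((hc b ω).comp he)) hm

lemma S_joint (hc : ∀ n ω, Continuous fun x => W n x ω) (e : ι → E d) (he : Continuous e) (γ : ℝ)
    (T : ℕ) (hm : ∀ j z, Measurable (inc W (T + j, T, e z))) (n : ℕ) :
    Measurable fun p : ι × Ω => S γ W T n (e p.1) p.2 :=
  (inc_joint hc e he _ _ (hm n)).const_sub _

lemma V_joint (hc : ∀ n ω, Continuous fun x => W n x ω) (e : ι → E d) (he : Continuous e) (γ : ℝ)
    (T : ℕ) (hm : ∀ j z, Measurable (inc W (T + j, T, e z))) (n : ℕ) :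
    Measurable fun p : ι × Ω => V γ W T n (e p.1) p.2 := by
  induction n with
  | zero => exact measurable_const
  | succ j ih =>
    refine ih.mul (Measurable.mul ?_ ?_)
    · have : Measurable fun p : ι × Ω => inc W (T + j + 1, T + j, e p.1) p.2 := by
        refine inc_joint hc e he _ _ fun z => ?_
        have : inc W (T + j + 1, T + j, e z) = fun ω => inc W (T + j + 1, T, e z) ω - inc W (T + j, T, e z) ω := by
          funext ω; simp [inc]
        rw [this]
        exact (hm (j + 1) z).sub (hm j z)
      exact ENNReal.measurable_ofReal.comp (Real.measurable_exp.comp ((this.const_mul γ).sub_const _))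
    · exact Measurable.ite (measurableSet_lt measurable_const (S_joint hc e he γ T hm (j + 1)))
        measurable_const measurable_const

lemma Wt_joint (hc : ∀ n ω, Continuous fun x => W n x ω) (e : ι → E d) (he : Continuous e) (γ : ℝ)
    (T : ℕ) (hm : ∀ j z, Measurable (inc W (T + j, T, e z))) (n : ℕ) :
    Measurable fun p : ι × Ω => Wt γ W T n (e p.1) p.2 :=
  (V_joint hc e he γ T hm n).mul (ENNReal.measurable_ofReal.comp (S_joint hc e he γ T hm n))

lemma Z_meas (hc : ∀ n ω, Continuous fun x => W n x ω) (γ : ℝ) (T : ℕ) {B : Set (E d)}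
    (hB : MeasurableSet B) (hm : ∀ j, ∀ z ∈ B, Measurable (inc W (T + j, T, z))) (n : ℕ) :
    Measurable (Z γ W T n B) := by
  have h1 := Wt_joint (ι := B) hc Subtype.val continuous_subtype_val γ T (fun j z => hm j z z.2) n
  have h2 : Z γ W T n B = fun ω => ∫⁻ x : B, Wt γ W T n x ω ∂(Measure.comap Subtype.val volume) := by
    funext ω
    rw [Z, ← lintegral_subtype_comap hB]
  rw [h2]
  have : SFinite (Measure.comap (Subtype.val : B → E d) volume) := by
    have : SigmaFinite (Measure.comap (Subtype.val : B → E d) volume) := by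
      have : SigmaFinite (Measure.map (Subtype.val : B → E d) (Measure.comap Subtype.val volume)) := by
        rw [map_comap_subtype_coe hB]; infer_instance
      exact SigmaFinite.of_map _ measurable_subtype_coe.aemeasurable this
    infer_instance
  exact h1.lintegral_prod_left'

end joint

variable {d : ℕ} {Ω : Type*} [m0 : MeasurableSpace Ω] {P : Measure Ω}
    {W : ℕ → E d → Ω → ℝ} {K : ℕ → E d → ℝ} {R L : ℝ}

lemma Z_meas_sig (h : CritField P W K R L) (γ : ℝ) (T : ℕ) {B : Set (E d)} (hB : MeasurableSet B) (n : ℕ)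
    {I : Set (ℕ × ℕ × E d)} (hI : ∀ j, ∀ z ∈ B, (T + j, T, z) ∈ I) :
    Measurable[sig W I] (Z γ W T n B) :=
  @Z_meas d Ω (sig W I) W h.cont γ T B hB (fun j z hz => inc_meas_sig I (hI j z hz)) n

lemma Wt_meas_sig {I : Set (ℕ × ℕ × E d)} (γ : ℝ) (T j : ℕ) (x : E d)
    (hI : ∀ i, i ≤ j → (T + i, T, x) ∈ I) : Measurable[sig W I] (Wt γ W T j x) :=
  (V_meas_sig γ T j x hI).mul (ENNReal.measurable_ofReal.comp (S_meas_sig γ T j x (hI j le_rfl)))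

lemma Wt_joint' (h : CritField P W K R L) (γ : ℝ) (T n : ℕ) :
    Measurable fun p : E d × Ω => Wt γ W T n p.1 p.2 :=
  Wt_joint (ι := E d) h.cont id continuous_id γ T (fun _ _ => measurable_inc h _) n

lemma two_chain [IsProbabilityMeasure P] (h : CritField P W K R L) (γ : ℝ) (T : ℕ) (x y : E d)
    {φ : ℝ → ENNReal} (hφ : Measurable φ) (hs : ∀ y, 0 ≤ y → PK φ y ≤ φ y)
    {m n : ℕ} (hmn : m ≤ n) (hxy : m < n → R * Real.exp (-((T + m : ℕ) : ℝ)) ≤ ‖x - y‖) :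
    ∫⁻ ω, (V γ W T n y ω * φ (S γ W T n y ω)) * (V γ W T n x ω * φ (S γ W T n x ω)) ∂P
      ≤ ∫⁻ ω, (V γ W T m y ω * φ (S γ W T m y ω)) * (V γ W T m x ω * φ (S γ W T m x ω)) ∂P := by
  induction n, hmn using Nat.le_induction with
  | base => exact le_rfl
  | succ j hj ih =>
    have hx := hxy (by omega)
    refine le_trans ?_ (ih fun _ => hx)
    rw [two_step h γ T j x y (le_trans ?_ hx) hφ]
    · have : ∀ z ω, V γ W T j z ω * PK φ (S γ W T j z ω) ≤ V γ W T j z ω * φ (S γ W T j z ω) := by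
        intro z ω
        by_cases hV : V γ W T j z ω = 0
        · simp [hV]
        · gcongr; exact hs _ (S_nonneg_of_V hV)
      exact lintegral_mono fun ω => mul_le_mul' (this y ω) (this x ω)
    · have := h.R2
      gcongr

lemma diag_bound [IsProbabilityMeasure P] (h : CritField P W K R L) {γ δ C : ℝ} (hδ : 0 < δ) (hC : 0 < C) (T m : ℕ)
    (x y : E d) {G : ℝ → ℝ} (hG : Measurable G) (hG0 : ∀ y, 0 ≤ y → y ≤ G y)
    (hGC : ∀ y, 0 ≤ y → Real.exp (-γ * y) * (G y) ^ 2 ≤ C * Real.exp (-(γ / 2) * y)) :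
    ∫⁻ ω, (V γ W T m y ω * ENNReal.ofReal (G (S γ W T m y ω))) *
        (V γ W T m x ω * ENNReal.ofReal (G (S γ W T m x ω))) ∂P
      ≤ ENNReal.ofReal (2 * (C / δ) * Real.exp (γ ^ 2 / 2 * m)) *
          (PK^[m] (fun y => ENNReal.ofReal (δ * Real.exp (-(γ / 2) * y)))) 0 := by
  have hpt : ∀ z ω, (V γ W T m z ω * ENNReal.ofReal (G (S γ W T m z ω))) ^ 2
      ≤ ENNReal.ofReal ((C / δ) * Real.exp (γ ^ 2 / 2 * m)) *
        (V γ W T m z ω * ENNReal.ofReal (δ * Real.exp (-(γ / 2) * S γ W T m z ω))) := by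
    intro z ω
    by_cases hV : V γ W T m z ω = 0
    · simp [hV]
    have hS := S_nonneg_of_V hV
    have hGn : 0 ≤ G (S γ W T m z ω) := hS.trans (hG0 _ hS)
    rw [mul_pow, sq (V γ W T m z ω), V_sq, ← ENNReal.ofReal_pow hGn]
    rw [mul_assoc (V γ W T m z ω),
      mul_left_comm (ENNReal.ofReal (C / δ * _))]
    rw [← ENNReal.ofReal_mul (Real.exp_pos _).le, ← ENNReal.ofReal_mul (by positivity)]
    refine mul_le_mul' le_rfl (ENNReal.ofReal_le_ofReal ?_)
    have e : Real.exp (γ * inc W (T + m, T, z) ω - γ ^ 2 / 2 * m)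
        = Real.exp (γ ^ 2 / 2 * m) * Real.exp (-γ * S γ W T m z ω) := by
      rw [← Real.exp_add]; congr 1; simp only [S]; ring
    rw [e, mul_assoc]
    calc Real.exp (γ ^ 2 / 2 * m) * (Real.exp (-γ * S γ W T m z ω) * G (S γ W T m z ω) ^ 2)
        ≤ Real.exp (γ ^ 2 / 2 * m) * (C * Real.exp (-(γ / 2) * S γ W T m z ω)) :=
          mul_le_mul_of_nonneg_left (hGC _ hS) (Real.exp_pos _).le
      _ = _ := by field_simp
  have hm1 : ∀ z, Measurable (V γ W T m z) := fun z =>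
    (V_meas_sig γ T m z (I := Set.univ) (fun _ _ => trivial)).mono (sig_le h _) le_rfl
  have hm2 : ∀ z, Measurable (S γ W T m z) := fun z =>
    (S_meas_sig γ T m z (I := Set.univ) trivial).mono (sig_le h _) le_rfl
  have hI : ∀ z, ∫⁻ ω, (V γ W T m z ω * ENNReal.ofReal (G (S γ W T m z ω))) ^ 2 ∂P
      ≤ ENNReal.ofReal ((C / δ) * Real.exp (γ ^ 2 / 2 * m)) *
          (PK^[m] (fun y => ENNReal.ofReal (δ * Real.exp (-(γ / 2) * y)))) 0 := by
    intro z
    refine (lintegral_mono (hpt z)).trans ?_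
    have hmm : Measurable fun ω => V γ W T m z ω * ENNReal.ofReal (δ * Real.exp (-(γ / 2) * S γ W T m z ω)) := by
      have := hm2 z; have := hm1 z; fun_prop
    rw [lintegral_const_mul _ hmm,
      one_point h γ T m z (φ := fun y => ENNReal.ofReal (δ * Real.exp (-(γ / 2) * y))) (by fun_prop)]
  have hab : ∀ a b : ENNReal, a * b ≤ a ^ 2 + b ^ 2 := by
    intro a b
    rcases le_total a b with hle | hle
    · calc a * b ≤ b * b := by gcongr
        _ ≤ _ := by rw [sq b]; exact le_add_self
    · calc a * b ≤ a * a := by gcongr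
        _ ≤ _ := by rw [sq a]; exact le_self_add
  calc _ ≤ ∫⁻ ω, ((V γ W T m y ω * ENNReal.ofReal (G (S γ W T m y ω))) ^ 2 +
        (V γ W T m x ω * ENNReal.ofReal (G (S γ W T m x ω))) ^ 2) ∂P := lintegral_mono fun ω => hab _ _
    _ ≤ _ := by
      rw [lintegral_add_left (by have := hm2 y; have := hm1 y; fun_prop)]
      refine (add_le_add (hI y) (hI x)).trans_eq ?_
      rw [← two_mul, ← mul_assoc]
      congr 1
      rw [mul_assoc 2, ENNReal.ofReal_mul (by norm_num : (0:ℝ) ≤ 2)]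
      simp

lemma pair_bound [IsProbabilityMeasure P] (h : CritField P W K R L) {γ δ C : ℝ} (hδ : 0 < δ) (hC : 0 < C) (T n : ℕ)
    (x y x0 : E d) (hx : x ∈ Metric.closedBall x0 (Real.exp (-(T:ℝ)))) (hy : y ∈ Metric.closedBall x0 (Real.exp (-(T:ℝ))))
    {G : ℝ → ℝ} (hG : Measurable G) (hG0 : ∀ y, 0 ≤ y → y ≤ G y)
    (hGS : ∀ y, 0 ≤ y → PK (fun z => ENNReal.ofReal (G z)) y ≤ ENNReal.ofReal (G y))
    (hGC : ∀ y, 0 ≤ y → Real.exp (-γ * y) * (G y) ^ 2 ≤ C * Real.exp (-(γ / 2) * y)) :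
    ∫⁻ ω, Wt γ W T n y ω * Wt γ W T n x ω ∂P ≤
      ∑ m ∈ Finset.range (n + 1), ENNReal.ofReal (2 * (C / δ) * Real.exp (γ ^ 2 / 2 * m)) *
          (PK^[m] (fun y => ENNReal.ofReal (δ * Real.exp (-(γ / 2) * y)))) 0 *
          (Metric.closedBall x (R * Real.exp 1 * Real.exp (-((T + m : ℕ) : ℝ)))).indicator 1 y := by
  have hR := h.R2
  -- choose the scale
  have hscale : ∃ m ≤ n, (m < n → R * Real.exp (-((T + m : ℕ) : ℝ)) ≤ ‖x - y‖) ∧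
      ‖x - y‖ ≤ R * Real.exp 1 * Real.exp (-((T + m : ℕ) : ℝ)) := by
    classical
    have hex : ∃ m, (m < n → R * Real.exp (-((T + m : ℕ) : ℝ)) ≤ ‖x - y‖) := ⟨n, fun h => absurd h (lt_irrefl _)⟩
    refine ⟨Nat.find hex, ?_, Nat.find_spec hex, ?_⟩
    · exact Nat.find_min' hex (fun h => absurd h (lt_irrefl _))
    · rcases Nat.eq_zero_or_pos (Nat.find hex) with h0 | h0
      · rw [h0]
        have h1 : ‖x - y‖ ≤ 2 * Real.exp (-(T:ℝ)) := by
          rw [← dist_eq_norm]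
          have := dist_triangle_right x y x0
          rw [Metric.mem_closedBall] at hx hy
          linarith
        refine h1.trans ?_
        have h2 : (1:ℝ) ≤ Real.exp 1 := Real.one_le_exp (by norm_num)
        simp only [add_zero]
        gcongr
        nlinarith
      · obtain ⟨m, hm⟩ : ∃ m, Nat.find hex = m + 1 := ⟨_, (Nat.succ_pred_eq_of_pos h0).symm⟩
        have := Nat.find_min hex (m := m) (by omega)
        push Not at this
        rw [hm, mul_assoc, ← Real.exp_add]
        refine this.2.le.trans_eq ?_
        congr 2; push_cast; ring
  obtain ⟨m, hmn, hsep, hclose⟩ := hscale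
  have hle : ∀ z ω, Wt γ W T n z ω ≤ V γ W T n z ω * ENNReal.ofReal (G (S γ W T n z ω)) := by
    intro z ω
    unfold Wt
    by_cases hV : V γ W T n z ω = 0
    · simp [hV]
    · gcongr; exact hG0 _ (S_nonneg_of_V hV)
  refine (lintegral_mono fun ω => mul_le_mul' (hle y ω) (hle x ω)).trans ?_
  refine (two_chain h γ T x y (φ := fun z => ENNReal.ofReal (G z)) (by fun_prop) hGS hmn hsep).trans ?_
  refine (diag_bound h hδ hC T m x y hG hG0 hGC).trans ?_
  refine le_trans ?_ (Finset.single_le_sum (fun _ _ => zero_le) (Finset.mem_range.2 (Nat.lt_succ_of_le hmn)))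
  rw [Set.indicator_of_mem]
  · simp
  · rw [Metric.mem_closedBall, dist_comm, dist_eq_norm]; exact hclose

lemma paley_zygmund [IsProbabilityMeasure P] {Y : Ω → ENNReal} (hY : Measurable Y) {c D : ENNReal}
    (hc0 : c ≠ 0) (hc : c ≠ ⊤) (hD : D ≠ ⊤) (h1 : c ≤ ∫⁻ ω, Y ω ∂P) (h2 : ∫⁻ ω, Y ω ^ 2 ∂P ≤ D) :
    P {ω | Y ω < c / 2} ≤ 1 - (c / 2) ^ 2 / D := by
  set A := {ω | c / 2 ≤ Y ω} with hA
  have hAm : MeasurableSet A := measurableSet_le measurable_const hY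
  have hc2 : c / 2 + c / 2 = c := ENNReal.add_halves c
  have hsplit : ∫⁻ ω, Y ω ∂P ≤ c / 2 + ∫⁻ ω, Y ω * A.indicator 1 ω ∂P := by
    calc ∫⁻ ω, Y ω ∂P ≤ ∫⁻ ω, (c / 2 + Y ω * A.indicator 1 ω) ∂P := by
          apply lintegral_mono
          intro ω
          by_cases hω : ω ∈ A
          · simp [hω]
          · simp only [hA, Set.mem_ofPred_eq, not_le] at hω
            exact hω.le.trans le_self_add
      _ = _ := by
          rw [lintegral_add_left measurable_const]; simp
  have hCS : ∫⁻ ω, Y ω * A.indicator 1 ω ∂P ≤ (D) ^ (1 / 2 : ℝ) * (P A) ^ (1 / 2 : ℝ) := by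
    have := ENNReal.lintegral_mul_le_Lp_mul_Lq P (p := 2) (q := 2)
      (Real.HolderConjugate.two_two) hY.aemeasurable
      (g := A.indicator 1) ((measurable_one.indicator hAm).aemeasurable)
    refine this.trans ?_
    gcongr
    · refine le_trans (le_of_eq ?_) h2
      simp
    · rw [← lintegral_indicator_one hAm]
      apply lintegral_mono
      intro ω
      by_cases hω : ω ∈ A <;> simp [hω]
  have h3 : c / 2 ≤ (D) ^ (1 / 2 : ℝ) * (P A) ^ (1 / 2 : ℝ) := by
    have this := hc2.trans_le (h1.trans (hsplit.trans (add_le_add_right hCS _)))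
    have hne : c / 2 ≠ ⊤ := ENNReal.div_ne_top hc (by norm_num)
    exact (ENNReal.add_le_add_iff_left hne).1 this
  have h4 : (c / 2) ^ 2 ≤ D * P A := by
    calc (c / 2) ^ 2 ≤ ((D) ^ (1 / 2 : ℝ) * (P A) ^ (1 / 2 : ℝ)) ^ 2 := by gcongr
      _ = D * P A := by
        rw [← ENNReal.mul_rpow_of_nonneg _ _ (by norm_num), ← ENNReal.rpow_natCast, ← ENNReal.rpow_mul]
        norm_num
  have h5 : (c / 2) ^ 2 / D ≤ P A := ENNReal.div_le_of_le_mul' h4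
  have : {ω | Y ω < c / 2} = Aᶜ := by ext ω; simp [hA]
  rw [this, prob_compl_eq_one_sub hAm]
  gcongr

lemma block_prob [IsProbabilityMeasure P] (h : CritField P W K R L) {γ : ℝ} (hγ : 0 < γ) (hγd : γ ^ 2 = 2 * d) :
    ∃ ρ : ENNReal, ρ < 1 ∧ ∃ l : ℝ, 0 < l ∧ ∀ (T n : ℕ) (x0 : E d), 1 ≤ n →
      P {ω | Z γ W T n (Metric.closedBall x0 (Real.exp (-(T:ℝ)))) ω
        < ENNReal.ofReal (l * Real.exp (-(d * T : ℝ)))} ≤ ρ := by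
  obtain ⟨G, δ, C, hδ, hC, hG, hG0, hGS, hGC⟩ := exists_super γ hγ
  have hR := h.R2
  set v : ENNReal := volume (Metric.ball (0 : E d) 1) with hv
  have hv0 : v ≠ 0 := (Metric.measure_ball_pos _ _ one_pos).ne'
  have hvt : v ≠ ⊤ := measure_ball_lt_top.ne
  set c1 : ENNReal := min c0 1 with hc1
  have hc10 : c1 ≠ 0 := (lt_min c0_pos one_pos).ne'
  have hc1t : c1 ≠ ⊤ := ((min_le_right _ _).trans_lt ENNReal.one_lt_top).ne
  set C3 : ENNReal := ENNReal.ofReal (2 * (C / δ) * (R * Real.exp 1) ^ d) * ENNReal.ofReal (G 0) with hC3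
  have hC3t : C3 ≠ ⊤ := ENNReal.mul_ne_top ENNReal.ofReal_ne_top ENNReal.ofReal_ne_top
  refine ⟨1 - (c1 / 2) ^ 2 / C3, ?_, (c1 * v / 2).toReal, ?_, ?_⟩
  · apply ENNReal.sub_lt_self ENNReal.one_ne_top one_ne_zero
    exact (ENNReal.div_pos (pow_ne_zero _ (ENNReal.div_pos hc10 (by norm_num)).ne') hC3t).ne'
  · exact ENNReal.toReal_pos (ENNReal.div_pos (mul_ne_zero hc10 hv0) (by norm_num)).ne'
      (ENNReal.div_ne_top (ENNReal.mul_ne_top hc1t hvt) (by norm_num))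
  intro T n x0 hn
  set B := Metric.closedBall x0 (Real.exp (-(T:ℝ))) with hB
  have hBm : MeasurableSet B := measurableSet_closedBall
  have hvol : ∀ (z : E d) (r : ℝ), 0 ≤ r → volume (Metric.closedBall z r) = ENNReal.ofReal (r ^ d) * v := by
    intro z r hr
    rw [Measure.addHaar_closedBall _ _ hr, finrank_euclideanSpace_fin]
  set s : ENNReal := ENNReal.ofReal (Real.exp (-(d * T : ℝ))) with hs
  have hs0 : s ≠ 0 := by simp [hs, Real.exp_pos]
  have hst : s ≠ ⊤ := ENNReal.ofReal_ne_top
  have hvB : volume B = s * v := by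
    rw [hB, hvol _ _ (Real.exp_pos _).le, hs, ← Real.exp_nat_mul]; congr 3; ring
  have hJ := Wt_joint' h γ T n
  have hZm : Measurable (Z γ W T n B) := Z_meas h.cont γ T hBm (fun _ _ _ => measurable_inc h _) n
  have hfirst : c1 * (s * v) ≤ ∫⁻ ω, Z γ W T n B ω ∂P := by
    unfold Z
    rw [lintegral_lintegral_swap (by exact (hJ.comp measurable_swap).aemeasurable)]
    have : ∀ x, ∫⁻ ω, Wt γ W T n x ω ∂P = (PK^[n] (fun z => ENNReal.ofReal z)) 0 := fun x =>
      one_point h γ T n x (φ := fun z => ENNReal.ofReal z) (by fun_prop)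
    simp only [this, lintegral_const, Measure.restrict_apply_univ, hvB]
    gcongr
    obtain ⟨j, rfl⟩ : ∃ j, n = j + 1 := ⟨n - 1, by omega⟩
    exact (min_le_left _ _).trans (PKit_lower j)
  have hsecond : ∫⁻ ω, Z γ W T n B ω ^ 2 ∂P ≤ C3 * (s * v) ^ 2 := by
    have hWm : ∀ x, Measurable (Wt γ W T n x) := fun x => hJ.comp measurable_prodMk_left
    have hWx : ∀ ω, Measurable fun x => Wt γ W T n x ω := fun ω => hJ.comp measurable_prodMk_right
    have e1 : ∀ ω, Z γ W T n B ω ^ 2 = ∫⁻ x in B, ∫⁻ y in B, Wt γ W T n y ω * Wt γ W T n x ω := by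
      intro ω
      simp_rw [fun x => lintegral_mul_const (μ := volume.restrict B) (Wt γ W T n x ω) (hWx ω)]
      rw [lintegral_const_mul _ (hWx ω), sq]; rfl
    have hJ3 : Measurable fun p : (E d × Ω) × E d => Wt γ W T n p.2 p.1.2 * Wt γ W T n p.1.1 p.1.2 := by
      exact (hJ.comp (measurable_snd.prodMk (measurable_snd.comp measurable_fst))).mul (hJ.comp measurable_fst)
    have e2 : ∫⁻ ω, Z γ W T n B ω ^ 2 ∂P
        = ∫⁻ x in B, ∫⁻ y in B, ∫⁻ ω, Wt γ W T n y ω * Wt γ W T n x ω ∂P := by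
      simp_rw [e1]
      rw [lintegral_lintegral_swap]
      · apply lintegral_congr
        intro x
        rw [lintegral_lintegral_swap]
        refine Measurable.aemeasurable ?_
        exact (hJ.comp measurable_swap).mul ((hWm x).comp measurable_fst)
      · refine Measurable.aemeasurable ?_
        have := hJ3.lintegral_prod_right' (ν := volume.restrict B)
        exact this.comp measurable_swap
    rw [e2]
    set a : ℕ → ENNReal := fun m => (PK^[m] (fun y => ENNReal.ofReal (δ * Real.exp (-(γ / 2) * y)))) 0 with ha
    have hb : ∀ x ∈ B, ∫⁻ y in B, ∫⁻ ω, Wt γ W T n y ω * Wt γ W T n x ω ∂P ≤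
        C3 * (s * v) := by
      intro x hx
      calc ∫⁻ y in B, ∫⁻ ω, Wt γ W T n y ω * Wt γ W T n x ω ∂P
          ≤ ∫⁻ y in B, ∑ m ∈ Finset.range (n + 1), ENNReal.ofReal (2 * (C / δ) * Real.exp (γ ^ 2 / 2 * m)) *
          a m * (Metric.closedBall x (R * Real.exp 1 * Real.exp (-((T + m : ℕ) : ℝ)))).indicator 1 y := by
            refine setLIntegral_mono' hBm fun y hy => ?_
            exact pair_bound h hδ hC T n x y x0 hx hy hG hG0 (fun y hy => le_self_add.trans (hGS y hy)) hGC
        _ ≤ ∫⁻ y, ∑ m ∈ Finset.range (n + 1), ENNReal.ofReal (2 * (C / δ) * Real.exp (γ ^ 2 / 2 * m)) *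
          a m * (Metric.closedBall x (R * Real.exp 1 * Real.exp (-((T + m : ℕ) : ℝ)))).indicator 1 y :=
            setLIntegral_le_lintegral _ _
        _ = ∑ m ∈ Finset.range (n + 1), ENNReal.ofReal (2 * (C / δ) * Real.exp (γ ^ 2 / 2 * m)) *
          a m * (ENNReal.ofReal ((R * Real.exp 1 * Real.exp (-((T + m : ℕ) : ℝ))) ^ d) * v) := by
            rw [lintegral_finsetSum]
            · apply Finset.sum_congr rfl
              intro m _
              rw [lintegral_const_mul _ (measurable_one.indicator measurableSet_closedBall),
                lintegral_indicator_one measurableSet_closedBall, hvol _ _ (by positivity)]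
            · intro m _
              exact (measurable_one.indicator measurableSet_closedBall).const_mul _
        _ = ∑ m ∈ Finset.range (n + 1), (ENNReal.ofReal (2 * (C / δ) * (R * Real.exp 1) ^ d) * (s * v)) * a m := by
            apply Finset.sum_congr rfl
            intro m _
            have : ENNReal.ofReal (2 * (C / δ) * Real.exp (γ ^ 2 / 2 * m)) *
              ENNReal.ofReal ((R * Real.exp 1 * Real.exp (-((T + m : ℕ) : ℝ))) ^ d)
              = ENNReal.ofReal (2 * (C / δ) * (R * Real.exp 1) ^ d) * s := by
              rw [hs, ← ENNReal.ofReal_mul (by positivity), ← ENNReal.ofReal_mul (by positivity)]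
              congr 1
              rw [mul_pow _ (Real.exp _) d, ← Real.exp_nat_mul, hγd]
              have : Real.exp (-(d * T : ℝ)) = Real.exp (2 * (d:ℝ) / 2 * m) * Real.exp (d * -((T + m : ℕ) : ℝ)) := by
                rw [← Real.exp_add]; congr 1; push_cast; ring
              rw [this]; ring
            calc _ = (ENNReal.ofReal (2 * (C / δ) * Real.exp (γ ^ 2 / 2 * m)) *
              ENNReal.ofReal ((R * Real.exp 1 * Real.exp (-((T + m : ℕ) : ℝ))) ^ d)) * v * a m := by ring
              _ = _ := by rw [this]; ring
        _ ≤ C3 * (s * v) := by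
            rw [← Finset.mul_sum, hC3]
            have hgr := le_self_add.trans (green_bound hG hGS (n + 1))
            calc _ ≤ ENNReal.ofReal (2 * (C / δ) * (R * Real.exp 1) ^ d) * (s * v) * ENNReal.ofReal (G 0) := by
                  gcongr
              _ = _ := by ring
    calc _ ≤ ∫⁻ x in B, C3 * (s * v) := setLIntegral_mono' hBm hb
      _ = _ := by rw [lintegral_const, Measure.restrict_apply_univ, hvB]; ring
  have hsv0 : s * v ≠ 0 := mul_ne_zero hs0 hv0
  have hsvt : s * v ≠ ⊤ := ENNReal.mul_ne_top hst hvt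
  have hpz := paley_zygmund hZm (mul_ne_zero hc10 hsv0) (ENNReal.mul_ne_top hc1t hsvt)
    (ENNReal.mul_ne_top hC3t (ENNReal.pow_ne_top hsvt)) hfirst hsecond
  have e3 : c1 * (s * v) / 2 = c1 / 2 * (s * v) := by simp only [div_eq_mul_inv]; ring
  have e4 : ENNReal.ofReal ((c1 * v / 2).toReal * Real.exp (-(d * T : ℝ))) = c1 * (s * v) / 2 := by
    rw [ENNReal.ofReal_mul ENNReal.toReal_nonneg, ENNReal.ofReal_toReal
      (ENNReal.div_ne_top (ENNReal.mul_ne_top hc1t hvt) (by norm_num))]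
    simp only [div_eq_mul_inv, hs]; ring
  rw [e4]
  refine hpz.trans_eq ?_
  rw [e3, mul_pow, ENNReal.mul_div_mul_right _ _ (pow_ne_zero _ hsv0) (ENNReal.pow_ne_top hsvt)]

end DerivMeas

namespace DerivMeas

set_option linter.unusedSectionVars false
set_option linter.unusedVariables false

variable {d : ℕ} {Ω : Type*} [m0 : MeasurableSpace Ω] {P : Measure Ω}
    {W : ℕ → E d → Ω → ℝ} {K : ℕ → E d → ℝ} {R L : ℝ}

lemma all_blocks [IsProbabilityMeasure P] (h : CritField P W K R L) (γ : ℝ) (T n N : ℕ) (x : Fin N → E d)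
    (hx : ∀ i j, i ≠ j → (R + 2) * Real.exp (-(T:ℝ)) ≤ ‖x i - x j‖) {c ρ : ENNReal}
    (hρ : ∀ x0, P {ω | Z γ W T n (Metric.closedBall x0 (Real.exp (-(T:ℝ)))) ω < c} ≤ ρ) :
    P {ω | ∀ i, Z γ W T n (Metric.closedBall (x i) (Real.exp (-(T:ℝ)))) ω < c} ≤ ρ ^ N := by
  set B : Fin N → Set (E d) := fun i => Metric.closedBall (x i) (Real.exp (-(T:ℝ))) with hB
  set I : Fin N → Set (ℕ × ℕ × E d) := fun i => {p | ∃ j, ∃ z ∈ B i, p = (T + j, T, z)} with hI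
  have hind : iIndep (fun i => sig W (I i)) P := by
    refine iIndep_sig h fun i j hij p hp q hq => ?_
    obtain ⟨m, z, hz, rfl⟩ := hp
    obtain ⟨m', w, hw, rfl⟩ := hq
    have hsep : R * Real.exp (-(T:ℝ)) ≤ ‖z - w‖ := by
      have h1 := hx i j hij
      simp only [hB, Metric.mem_closedBall] at hz hw
      rw [← dist_eq_norm] at h1 ⊢
      have h2 := dist_triangle4 (x i) z w (x j)
      rw [dist_comm] at hz
      linarith
    simp only [covK]
    rw [h.Ksep T (min (T + m) (T + m')) (z - w) (by omega) hsep,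
      h.Ksep T (min (T + m) T) (z - w) (by omega) hsep,
      h.Ksep T (min T (T + m')) (z - w) (by omega) hsep, min_self]
    ring
  have hms : ∀ i, MeasurableSet[sig W (I i)] {ω | Z γ W T n (B i) ω < c} := by
    intro i
    have := Z_meas_sig h γ T (B := B i) measurableSet_closedBall n (I := I i) (fun j z hz => ⟨j, z, hz, rfl⟩)
    exact measurableSet_lt this measurable_const
  have e : {ω | ∀ i, Z γ W T n (B i) ω < c} = ⋂ i, {ω | Z γ W T n (B i) ω < c} := by
    ext ω; simp
  rw [e, hind.meas_iInter hms]
  calc ∏ i, P {ω | Z γ W T n (B i) ω < c} ≤ ∏ i : Fin N, ρ := Finset.prod_le_prod' fun i _ => hρ _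
    _ = _ := by simp

lemma Z_fin (h : CritField P W K R L) (γ : ℝ) (T n : ℕ) {B : Set (E d)} (hB : Bornology.IsBounded B) (ω : Ω) :
    Z γ W T n B ω ≠ ⊤ := by
  have hcS : Continuous fun x => S γ W T n x ω := by
    unfold S inc
    exact continuous_const.sub ((h.cont _ ω).sub (h.cont _ ω))
  have hcI : Continuous fun x => inc W (T + n, T, x) ω := (h.cont _ ω).sub (h.cont _ ω)
  obtain ⟨r, hr⟩ := hB.subset_closedBall (0 : E d)
  obtain ⟨C, hC⟩ := (isCompact_closedBall (0 : E d) r).bddAbove_image (f := fun x =>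
    Real.exp (γ * inc W (T + n, T, x) ω - γ ^ 2 / 2 * n) * S γ W T n x ω) (by
      exact ((Real.continuous_exp.comp ((continuous_const.mul hcI).sub continuous_const)).mul hcS).continuousOn)
  have : Z γ W T n B ω ≤ ∫⁻ x in Metric.closedBall (0 : E d) r, ENNReal.ofReal C := by
    unfold Z
    refine (lintegral_mono_set hr).trans (setLIntegral_mono' measurableSet_closedBall fun x hx => ?_)
    unfold Wt
    refine (mul_le_mul' (V_le γ T n x ω) le_rfl).trans ?_
    rw [← ENNReal.ofReal_mul (Real.exp_pos _).le]
    exact ENNReal.ofReal_le_ofReal (hC ⟨x, hx, rfl⟩)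
  refine ne_top_of_le_ne_top ?_ this
  rw [lintegral_const, Measure.restrict_apply_univ]
  exact ENNReal.mul_ne_top ENNReal.ofReal_ne_top measure_closedBall_lt_top.ne

/-- total weighted mass. -/
def Vt (γ : ℝ) (W : ℕ → E d → Ω → ℝ) (T n : ℕ) (B : Set (E d)) (ω : Ω) : ENNReal :=
  ∫⁻ x in B, ENNReal.ofReal (Real.exp (γ * W T x ω - γ ^ 2 / 2 * T)) * Wt γ W T n x ω

lemma chernoff [IsProbabilityMeasure P] (h : CritField P W K R L) (T : ℕ) (x : E d) (a : ℝ) (ha : 0 ≤ a) :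
    ∫⁻ ω, (if W T x ω < -(a * T) then 1 else 0 : ENNReal) ∂P ≤ ENNReal.ofReal (Real.exp (-(a ^ 2 * T / 2))) := by
  have hW : W T x = inc W (T, 0, x) := by funext ω; simp [inc, h.zero]
  have hlaw : P.map (W T x) = gaussianReal 0 (T : NNReal) := by
    rw [hW, law_inc h]; congr 1
    simp [covK, h.K0]
  calc ∫⁻ ω, (if W T x ω < -(a * T) then 1 else 0 : ENNReal) ∂P
      ≤ ∫⁻ ω, ENNReal.ofReal (Real.exp (-(a ^ 2 * T))) * ENNReal.ofReal (Real.exp ((-a) * W T x ω)) ∂P := by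
        apply lintegral_mono
        intro ω
        dsimp only
        split_ifs with hω
        · rw [← ENNReal.ofReal_mul (Real.exp_pos _).le, ← Real.exp_add, ← ENNReal.ofReal_one]
          apply ENNReal.ofReal_le_ofReal
          apply Real.one_le_exp
          nlinarith
        · exact zero_le
    _ = ENNReal.ofReal (Real.exp (-(a ^ 2 * T))) * ∫⁻ z, ENNReal.ofReal (Real.exp ((-a) * z)) ∂(gaussianReal 0 (T : NNReal)) := by
        rw [lintegral_const_mul _ (by have := h.meas T x; fun_prop), ← hlaw, lintegral_map (by fun_prop) (h.meas T x)]
    _ = _ := by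
        rw [exp_lintegral, ← ENNReal.ofReal_mul (Real.exp_pos _).le, ← Real.exp_add]
        congr 2
        simp; ring

lemma tilt_prob [IsProbabilityMeasure P] (h : CritField P W K R L) {γ : ℝ} (hγ : 0 < γ) (T n : ℕ) {B : Set (E d)}
    (hBm : MeasurableSet B) (hBb : Bornology.IsBounded B) (a : ℝ) (ha : 0 ≤ a) (c : ENNReal) (hc : c ≠ 0) :
    P {ω | Vt γ W T n B ω < ENNReal.ofReal (Real.exp (-(γ * a + γ ^ 2 / 2) * T)) * (c / 2)} ≤
      P {ω | Z γ W T n B ω < c} + 2 * ENNReal.ofReal (Real.exp (-(a ^ 2 * T / 2))) := by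
  have hJ := Wt_joint' h γ T n
  have hWm : ∀ x, Measurable (Wt γ W T n x) := fun x => hJ.comp measurable_prodMk_left
  have hWx : ∀ ω, Measurable fun x => Wt γ W T n x ω := fun ω => hJ.comp measurable_prodMk_right
  have hZm : Measurable (Z γ W T n B) := Z_meas h.cont γ T hBm (fun _ _ _ => measurable_inc h _) n
  have hWT : Measurable fun p : E d × Ω => W T p.1 p.2 :=
    measurable_uncurry_of_continuous_of_measurable (u := fun (z : E d) ω => W T z ω) (fun ω => h.cont T ω) (h.meas T)
  set b : E d → Ω → ENNReal := fun x ω => if W T x ω < -(a * T) then 1 else 0 with hb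
  have hbJ : Measurable fun p : E d × Ω => b p.1 p.2 :=
    Measurable.ite (measurableSet_lt hWT measurable_const) measurable_const measurable_const
  set bad : Ω → ENNReal := fun ω => ∫⁻ x in B, b x ω * Wt γ W T n x ω with hbad
  have hbadm : Measurable bad := (hbJ.mul hJ).lintegral_prod_left' (μ := volume.restrict B)
  set good : Ω → ENNReal := fun ω => ∫⁻ x in B, (1 - b x ω) * Wt γ W T n x ω with hgood
  have hsum : ∀ ω, Z γ W T n B ω = good ω + bad ω := by
    intro ω
    simp only [hgood, hbad, Z]
    have h1 : Measurable fun x => (1 - b x ω) * Wt γ W T n x ω :=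
      ((measurable_const.sub (hbJ.comp measurable_prodMk_right)).mul (hWx ω))
    rw [← lintegral_add_left h1]
    apply lintegral_congr
    intro x
    simp only [hb]
    split_ifs <;> simp
  have hV : ∀ ω, ENNReal.ofReal (Real.exp (-(γ * a + γ ^ 2 / 2) * T)) * good ω ≤ Vt γ W T n B ω := by
    intro ω
    simp only [hgood, Vt]
    rw [← lintegral_const_mul' _ _ ENNReal.ofReal_ne_top]
    apply lintegral_mono
    intro x
    simp only [hb]
    split_ifs with hx
    · simp
    · simp only [tsub_zero, one_mul]
      refine mul_le_mul' (ENNReal.ofReal_le_ofReal (Real.exp_le_exp.2 ?_)) le_rfl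
      push Not at hx
      nlinarith
  have hsub : {ω | Vt γ W T n B ω < ENNReal.ofReal (Real.exp (-(γ * a + γ ^ 2 / 2) * T)) * (c / 2)} ⊆
      {ω | Z γ W T n B ω < c} ∪ {ω | 1 ≤ 2 * (bad ω * (Z γ W T n B ω)⁻¹)} := by
    intro ω hω
    simp only [Set.mem_ofPred_eq] at hω
    by_cases hz : Z γ W T n B ω < c
    · exact Or.inl hz
    right
    push Not at hz
    have hg : good ω < c / 2 := by
      by_contra hcon
      push Not at hcon
      exact absurd ((mul_le_mul' le_rfl hcon).trans (hV ω)) (not_le.2 hω)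
    have hg2 : good ω < Z γ W T n B ω / 2 := hg.trans_le (ENNReal.div_le_div_right hz _)
    have hb2 : Z γ W T n B ω / 2 ≤ bad ω := by
      by_contra hcon
      push Not at hcon
      have := ENNReal.add_lt_add hg2 hcon
      rw [ENNReal.add_halves, ← hsum] at this
      exact lt_irrefl _ this
    have hz0 : Z γ W T n B ω ≠ 0 := (lt_of_lt_of_le (pos_iff_ne_zero.2 hc) hz).ne'
    have hzt := Z_fin h γ T n hBb ω
    simp only [Set.mem_ofPred_eq]
    calc (1:ENNReal) = 2 * (Z γ W T n B ω / 2 * (Z γ W T n B ω)⁻¹) := by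
          rw [← mul_assoc, ENNReal.mul_div_cancel (by norm_num) (by norm_num), ENNReal.mul_inv_cancel hz0 hzt]
      _ ≤ _ := by gcongr
  refine (measure_mono hsub).trans ((measure_union_le _ _).trans (add_le_add_right ?_ _))
  have hm2 : Measurable fun ω => bad ω * (Z γ W T n B ω)⁻¹ := hbadm.mul hZm.inv
  have hmk := mul_meas_ge_le_lintegral (μ := P) (hm2.const_mul 2) 1
  rw [one_mul] at hmk
  refine hmk.trans ?_
  rw [lintegral_const_mul _ hm2]
  refine mul_le_mul' le_rfl ?_
  set p := ENNReal.ofReal (Real.exp (-(a ^ 2 * T / 2))) with hp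
  have e1 : ∀ ω, bad ω * (Z γ W T n B ω)⁻¹ = ∫⁻ x in B, b x ω * (Wt γ W T n x ω * (Z γ W T n B ω)⁻¹) := by
    intro ω
    have : Measurable fun x => b x ω * Wt γ W T n x ω := (hbJ.mul hJ).comp measurable_prodMk_right
    rw [hbad, ← lintegral_mul_const _ this]
    simp only [mul_assoc]
  simp_rw [e1]
  have hJ2 : Measurable fun p : E d × Ω => Wt γ W T n p.1 p.2 * (Z γ W T n B p.2)⁻¹ :=
    hJ.mul (hZm.inv.comp measurable_snd)
  rw [lintegral_lintegral_swap (by exact ((hbJ.mul hJ2).comp measurable_swap).aemeasurable)]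
  set I : Set (ℕ × ℕ × E d) := {p | ∃ j z, p = (T + j, T, z)} with hI
  have hx : ∀ x, ∫⁻ ω, b x ω * (Wt γ W T n x ω * (Z γ W T n B ω)⁻¹) ∂P ≤
      p * ∫⁻ ω, (Wt γ W T n x ω * (Z γ W T n B ω)⁻¹) ∂P := by
    intro x
    have hind : Indep (sig W {(T, 0, x)}) (sig W I) P := by
      refine indep_sig h fun p hp q hq => ?_
      obtain ⟨j, z, rfl⟩ := hq
      rw [Set.mem_singleton_iff] at hp
      subst hp
      simp [covK]
    have hbm : Measurable[sig W {(T, 0, x)}] (b x) := by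
      have h1 := inc_meas_sig (W := W) {(T, 0, x)} (Set.mem_singleton (T, 0, x))
      have hW : W T x = inc W (T, 0, x) := by funext ω; simp [inc, h.zero]
      rw [← hW] at h1
      exact Measurable.ite (measurableSet_lt h1 measurable_const) measurable_const measurable_const
    have hrm : Measurable[sig W I] fun ω => Wt γ W T n x ω * (Z γ W T n B ω)⁻¹ :=
      (Wt_meas_sig (I := I) γ T n x (fun i _ => ⟨i, x, rfl⟩)).mul
        (Z_meas_sig h γ T hBm n (I := I) (fun j z _ => ⟨j, z, rfl⟩)).inv
    have := lintegral_mul_eq_lintegral_mul_lintegral_of_independent_measurableSpace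
      (sig_le h {(T, 0, x)}) (sig_le h I) hind hbm hrm
    rw [this]
    exact mul_le_mul' (chernoff h T x a ha) le_rfl
  calc ∫⁻ x in B, ∫⁻ ω, b x ω * (Wt γ W T n x ω * (Z γ W T n B ω)⁻¹) ∂P
      ≤ ∫⁻ x in B, p * ∫⁻ ω, (Wt γ W T n x ω * (Z γ W T n B ω)⁻¹) ∂P := lintegral_mono fun x => hx x
    _ = p * ∫⁻ x in B, ∫⁻ ω, (Wt γ W T n x ω * (Z γ W T n B ω)⁻¹) ∂P :=
        lintegral_const_mul' _ _ ENNReal.ofReal_ne_top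
    _ = p * ∫⁻ ω, (∫⁻ x in B, (Wt γ W T n x ω * (Z γ W T n B ω)⁻¹)) ∂P := by
        rw [lintegral_lintegral_swap (by exact hJ2.aemeasurable)]
    _ ≤ p * ∫⁻ ω, 1 ∂P := by
        refine mul_le_mul' le_rfl (lintegral_mono fun ω => ?_)
        dsimp only
        rw [lintegral_mul_const _ (hWx ω)]
        exact ENNReal.mul_inv_le_one _
    _ = p := by simp

lemma total_prob [IsProbabilityMeasure P] (hd : 1 ≤ d) (h : CritField P W K R L) {γ : ℝ} (hγ : 0 < γ) (hγd : γ ^ 2 = 2 * d) :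
    ∃ ρ : ENNReal, ρ < 1 ∧ ∃ l : ℝ, 0 < l ∧ ∀ (T : ℕ) (x0 : E d) (r : ℝ), 0 < r →
      ∃ B ⊆ Metric.ball x0 r, MeasurableSet B ∧ ∀ n, 1 ≤ n → ∀ a, 0 ≤ a →
      P {ω | Vt γ W T n B ω < ENNReal.ofReal (l * Real.exp (-((γ * a + γ ^ 2) * T)))} ≤
        ρ ^ ⌊r * Real.exp T / (R + 3)⌋₊ + 2 * ENNReal.ofReal (Real.exp (-(a ^ 2 * T / 2))) := by
  obtain ⟨ρ, hρ, l, hl, hbl⟩ := block_prob h hγ hγd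
  refine ⟨ρ, hρ, l / 2, by positivity, ?_⟩
  intro T x0 r hr
  have hR := h.R2
  set N := ⌊r * Real.exp T / (R + 3)⌋₊ with hN
  set e : E d := EuclideanSpace.single (⟨0, hd⟩ : Fin d) (1:ℝ) with he
  have hen : ‖e‖ = 1 := by simp [he]
  set x : Fin N → E d := fun i => x0 + ((i : ℝ) * ((R + 2) * Real.exp (-(T:ℝ)))) • e with hx
  set B := ⋃ i, Metric.closedBall (x i) (Real.exp (-(T:ℝ))) with hB
  have hsep : ∀ i j, i ≠ j → (R + 2) * Real.exp (-(T:ℝ)) ≤ ‖x i - x j‖ := by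
    intro i j hij
    simp only [hx]
    rw [add_sub_add_left_eq_sub, ← sub_smul, norm_smul, hen, mul_one, ← sub_mul, norm_mul,
      Real.norm_of_nonneg (by positivity : 0 ≤ (R + 2) * Real.exp (-(T:ℝ)))]
    apply le_mul_of_one_le_left (by positivity)
    rw [Real.norm_eq_abs]
    have : (1:ℤ) ≤ |((i:ℕ):ℤ) - ((j:ℕ):ℤ)| := by
      apply Int.one_le_abs
      have : (i:ℕ) ≠ (j:ℕ) := fun hh => hij (Fin.ext hh)
      omega
    exact_mod_cast this
  have hBsub : B ⊆ Metric.ball x0 r := by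
    refine Set.iUnion_subset fun i y hy => ?_
    rw [Metric.mem_closedBall] at hy
    rw [Metric.mem_ball]
    have h1 : dist (x i) x0 = (i:ℝ) * ((R + 2) * Real.exp (-(T:ℝ))) := by
      simp only [hx]
      rw [dist_eq_norm, add_sub_cancel_left, norm_smul, hen, mul_one, Real.norm_of_nonneg (by positivity)]
    have h2 : ((i:ℕ):ℝ) + 1 ≤ N := by exact_mod_cast i.2
    have h3 : (N:ℝ) ≤ r * Real.exp T / (R + 3) := Nat.floor_le (by positivity)
    rw [le_div_iff₀ (by positivity)] at h3
    have h4 : (i:ℝ) * (R + 2) + 1 < r * Real.exp T := by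
      have : (0:ℝ) ≤ (i:ℕ) := Nat.cast_nonneg _
      nlinarith
    have h5 : ((i:ℝ) * (R + 2) + 1) * Real.exp (-(T:ℝ)) < r := by
      have := mul_lt_mul_of_pos_right h4 (Real.exp_pos (-(T:ℝ)))
      rwa [mul_assoc r, ← Real.exp_add, add_neg_cancel, Real.exp_zero, mul_one] at this
    have := dist_triangle y (x i) x0
    nlinarith
  have hBm : MeasurableSet B := MeasurableSet.iUnion fun i => measurableSet_closedBall
  refine ⟨B, hBsub, hBm, fun n hn a ha => ?_⟩
  have hB2 : Bornology.IsBounded B := Metric.isBounded_ball.subset hBsub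
  set c : ENNReal := ENNReal.ofReal (l * Real.exp (-(d * T : ℝ))) with hc
  have hc0 : c ≠ 0 := by
    simp only [hc, ne_eq, ENNReal.ofReal_eq_zero, not_le]; positivity
  have hm := tilt_prob h hγ T n hBm hB2 a ha c hc0
  have ec : ENNReal.ofReal (Real.exp (-(γ * a + γ ^ 2 / 2) * T)) * (c / 2) =
      ENNReal.ofReal (l / 2 * Real.exp (-((γ * a + γ ^ 2) * T))) := by
    have : c / 2 = ENNReal.ofReal (l * Real.exp (-(d * T : ℝ)) / 2) := by
      rw [ENNReal.ofReal_div_of_pos (by norm_num)]; simp [hc]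
    rw [this, ← ENNReal.ofReal_mul (Real.exp_pos _).le]
    congr 1
    have h2 : Real.exp (-((γ * a + γ ^ 2) * T)) = Real.exp (-(γ * a + γ ^ 2 / 2) * T) * Real.exp (-(d * T : ℝ)) := by
      rw [← Real.exp_add]; congr 1
      have : (d:ℝ) = γ ^ 2 / 2 := by rw [hγd]; ring
      rw [this]; ring
    rw [h2]; ring
  rw [ec] at hm
  refine hm.trans (add_le_add_left ?_ _)
  refine le_trans (measure_mono ?_) (all_blocks h γ T n N x hsep (c := c) (hbl T n · hn))
  intro ω hω i
  refine lt_of_le_of_lt ?_ hω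
  exact lintegral_mono_set (Set.subset_iUnion (fun i => Metric.closedBall (x i) (Real.exp (-(T:ℝ)))) i)

end DerivMeas

namespace DerivMeas

set_option linter.unusedSectionVars false
set_option linter.unusedVariables false

variable {d : ℕ} {Ω : Type*} [m0 : MeasurableSpace Ω] {P : Measure Ω}
    {W : ℕ → E d → Ω → ℝ} {K : ℕ → E d → ℝ} {R L : ℝ}

lemma exp_two [IsProbabilityMeasure P] (h : CritField P W K R L) (n : ℕ) (x c : E d) {α β : ℝ} (hαβ : 0 ≤ α * β) :
    ∫⁻ ω, ENNReal.ofReal (Real.exp (α * W n x ω - β * W n c ω)) ∂P ≤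
      ENNReal.ofReal (Real.exp ((α - β) ^ 2 / 2 * n + α * β * (L * ‖x - c‖ * Real.exp n))) := by
  classical
  set Y : Ω → ℝ := α • W n x - β • W n c with hY
  have hYm : Measurable Y := ((h.meas n x).const_smul α).sub ((h.meas n c).const_smul β)
  have hg : IsGaussianProcess (fun (_ : Unit) => Y) P := by
    refine IsGaussianProcess.of_isGaussianProcess h.gauss fun p => ⟨{(n, x), (n, c)},
      { toFun y := α * y ⟨(n, x), by simp⟩ - β * y ⟨(n, c), by simp⟩
        map_add' x y := by simp; ring
        map_smul' c x := by simp; ring },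
      fun ω => by simp [hY]⟩
  have hW := fun z => memLp_W h n z
  have hcov : cov[Y, Y; P] = (α - β) ^ 2 * n + 2 * α * β * (n - K n (x - c)) := by
    have hs := fun z => cov_W h n n z z
    have h1 := cov_W h n n x c
    have h2 := covariance_comm (W n c) (W n x) (μ := P)
    simp only [min_self, sub_self, h.K0] at hs h1
    rw [hY, covariance_sub_left ((hW x).const_smul α) ((hW c).const_smul β) (((hW x).const_smul α).sub ((hW c).const_smul β)),
      covariance_sub_right ((hW x).const_smul α) ((hW x).const_smul α) ((hW c).const_smul β),
      covariance_sub_right ((hW c).const_smul β) ((hW x).const_smul α) ((hW c).const_smul β)]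
    simp only [covariance_smul_left, covariance_smul_right]
    rw [h2, hs, hs, h1]
    ring
  have hlaw : P.map Y = gaussianReal 0 (cov[Y, Y; P]).toNNReal := by
    rw [(hg.hasGaussianLaw_eval ()).map_eq_gaussianReal, covariance_self hYm.aemeasurable]
    congr 1
    rw [hY]
    simp only [Pi.sub_apply, Pi.smul_apply, smul_eq_mul]
    rw [integral_sub (((hW _).integrable (by norm_num)).const_mul _) (((hW _).integrable (by norm_num)).const_mul _),
      integral_const_mul, integral_const_mul, h.cent, h.cent]
    simp
  have h0 : 0 ≤ cov[Y, Y; P] := by rw [covariance_self hYm.aemeasurable]; exact variance_nonneg _ _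
  have e : ∫⁻ ω, ENNReal.ofReal (Real.exp (α * W n x ω - β * W n c ω)) ∂P
      = ∫⁻ z, ENNReal.ofReal (Real.exp (1 * z)) ∂(P.map Y) := by
    rw [lintegral_map (by fun_prop) hYm]
    apply lintegral_congr; intro ω; simp [hY]
  rw [e, hlaw, exp_lintegral, Real.coe_toNNReal _ h0, hcov]
  apply ENNReal.ofReal_le_ofReal
  apply Real.exp_le_exp.2
  have := mul_le_mul_of_nonneg_left (h.Kclose n (x - c)) hαβ
  nlinarith

def Cη (η : ℝ) : ENNReal := ∫⁻ w : ℝ, ENNReal.ofReal (Real.exp (-η * |w|))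

lemma Cη_fin {η : ℝ} (hη : 0 < η) : Cη η ≠ ⊤ := by
  have : Integrable fun w : ℝ => Real.exp (-η * |w|) := by
    rw [← integrableOn_univ, ← Set.Iic_union_Ioi (a := (0:ℝ)), integrableOn_union]
    constructor
    · refine (integrableOn_exp_mul_Iic hη 0).congr_fun (fun w hw => ?_) measurableSet_Iic
      simp only [Set.mem_Iic] at hw
      simp [abs_of_nonpos hw]
    · refine (integrableOn_exp_mul_Ioi (neg_neg_of_pos hη) 0).congr_fun (fun w hw => ?_) measurableSet_Ioi
      simp only [Set.mem_Ioi] at hw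
      simp [abs_of_pos hw]
  exact this.lintegral_lt_top.ne

lemma h_bound [IsProbabilityMeasure P] (h : CritField P W K R L) (γ η : ℝ) (n : ℕ) (hn : 1 ≤ n) (c : E d) :
    ∫⁻ ω, ENNReal.ofReal (Real.exp (-γ * (γ * n - W n c ω) - η * |γ * n - W n c ω|)) ∂P ≤
      ENNReal.ofReal ((Real.sqrt n)⁻¹ * Real.exp (-(γ ^ 2 / 2 * n))) * Cη η := by
  have hW : W n c = inc W (n, 0, c) := by funext ω; simp [inc, h.zero]
  have hlaw : P.map (W n c) = gaussianReal 0 (n : NNReal) := by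
    rw [hW, law_inc h]; congr 1
    simp [covK, h.K0]
  have hn0 : (n : NNReal) ≠ 0 := by exact_mod_cast (by omega : n ≠ 0)
  have hnr : (0:ℝ) < n := by exact_mod_cast hn
  have e : ∫⁻ ω, ENNReal.ofReal (Real.exp (-γ * (γ * n - W n c ω) - η * |γ * n - W n c ω|)) ∂P
    = ∫⁻ w, ENNReal.ofReal (Real.exp (-γ * (γ * n - w) - η * |γ * n - w|)) ∂(gaussianReal 0 (n : NNReal)) := by
    rw [← hlaw, lintegral_map (by fun_prop) (h.meas n c)]
  rw [e, gaussianReal_of_var_ne_zero _ hn0,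
    lintegral_withDensity_eq_lintegral_mul _ (measurable_gaussianPDF 0 _) (by fun_prop)]
  have hC : Cη η = ∫⁻ w : ℝ, ENNReal.ofReal (Real.exp (-η * |γ * n - w|)) :=
    (lintegral_sub_left_eq_self (fun w : ℝ => ENNReal.ofReal (Real.exp (-η * |w|))) (γ * n)).symm
  rw [hC, ← lintegral_const_mul _ (by fun_prop)]
  apply lintegral_mono
  intro w
  simp only [Pi.mul_apply, gaussianPDF]
  rw [← ENNReal.ofReal_mul (gaussianPDFReal_nonneg _ _ _), ← ENNReal.ofReal_mul (by positivity)]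
  apply ENNReal.ofReal_le_ofReal
  simp only [gaussianPDFReal, NNReal.coe_natCast, sub_zero]
  have h1 : (Real.sqrt (2 * Real.pi * n))⁻¹ ≤ (Real.sqrt n)⁻¹ := by
    apply inv_anti₀ (Real.sqrt_pos.2 hnr)
    apply Real.sqrt_le_sqrt
    have := Real.pi_gt_three
    nlinarith
  rw [mul_assoc (Real.sqrt (2 * Real.pi * n))⁻¹, mul_assoc (Real.sqrt n)⁻¹, ← Real.exp_add, ← Real.exp_add]
  refine mul_le_mul h1 (Real.exp_le_exp.2 ?_) (Real.exp_pos _).le (by positivity)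
  have : -w ^ 2 / (2 * n) = -(w - γ * n) ^ 2 / (2 * n) - γ * w + γ ^ 2 / 2 * n := by field_simp; ring
  rw [this]
  have h2 : 0 ≤ (w - γ * n) ^ 2 / (2 * n) := by positivity
  rw [neg_div]
  nlinarith

lemma exists_cover {A : Set (E d)} {r : ℝ} (hr : 0 ≤ r) (hA : A ⊆ Metric.closedBall 0 r) (n : ℕ) :
    ∃ F : Finset (E d), A ⊆ ⋃ c ∈ F, Metric.closedBall c (Real.exp (-(n:ℝ))) ∧
      (F.card : ℝ) ≤ (2 * (r + 1)) ^ d * Real.exp (d * n) := by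
  classical
  set ε := Real.exp (-(n:ℝ)) with hε
  have hε0 : 0 < ε := Real.exp_pos _
  have hε1 : ε ≤ 1 := Real.exp_le_one_iff.2 (by simp)
  set M : ℝ := (2 * (r + 1)) ^ d * Real.exp (d * n) with hM
  have hMe : M * (ε / 2) ^ d = (r + 1) ^ d := by
    rw [hM, hε, div_pow, ← Real.exp_nat_mul, mul_pow]
    have : Real.exp (d * n) * Real.exp (d * (-(n:ℝ))) = 1 := by
      rw [← Real.exp_add]; simp
    have h2 : ((2:ℝ) ^ d) * ((2:ℝ) ^ d)⁻¹ = 1 := mul_inv_cancel₀ (by positivity)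
    rw [div_eq_mul_inv]
    linear_combination (r + 1) ^ d * (2 ^ d * (2 ^ d)⁻¹) * this + (r + 1) ^ d * h2
  let Q : Finset (E d) → Prop := fun F => (F : Set (E d)) ⊆ A ∧ ∀ x ∈ F, ∀ y ∈ F, x ≠ y → ε < dist x y
  have hcard : ∀ F, Q F → (F.card : ℝ) ≤ M := by
    intro F hF
    set v : ENNReal := volume (Metric.ball (0 : E d) 1) with hv
    have hv0 : v ≠ 0 := (Metric.measure_ball_pos _ _ one_pos).ne'
    have hvt : v ≠ ⊤ := measure_ball_lt_top.ne
    have hdis : (F : Set (E d)).PairwiseDisjoint fun c => Metric.closedBall c (ε / 2) := by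
      intro x hx y hy hxy
      apply Metric.closedBall_disjoint_closedBall
      have := hF.2 x hx y hy hxy
      linarith
    have h1 : volume (⋃ c ∈ F, Metric.closedBall c (ε / 2)) = ∑ c ∈ F, volume (Metric.closedBall c (ε / 2)) :=
      measure_biUnion_finset hdis fun _ _ => measurableSet_closedBall
    have h2 : volume (⋃ c ∈ F, Metric.closedBall c (ε / 2)) ≤ volume (Metric.closedBall (0 : E d) (r + 1)) := by
      apply measure_mono
      refine Set.iUnion₂_subset fun c hc => Metric.closedBall_subset_closedBall' ?_
      have := hA (hF.1 hc)
      rw [Metric.mem_closedBall] at this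
      linarith
    rw [h1] at h2
    simp_rw [Measure.addHaar_closedBall _ _ (by positivity : 0 ≤ ε / 2)] at h2
    rw [Measure.addHaar_closedBall _ _ (by positivity : 0 ≤ r + 1), Finset.sum_const, finrank_euclideanSpace_fin,
      nsmul_eq_mul, ← mul_assoc, ENNReal.mul_le_mul_iff_left hv0 hvt, ← ENNReal.ofReal_natCast,
      ← ENNReal.ofReal_mul (by positivity), ENNReal.ofReal_le_ofReal_iff (by positivity), ← hMe] at h2
    exact le_of_mul_le_mul_right h2 (by positivity)
  have hcard' : ∀ F, Q F → F.card ≤ ⌊M⌋₊ := fun F hF => Nat.le_floor (hcard F hF)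
  obtain ⟨F, hF, hmax⟩ : ∃ F, Q F ∧ ∀ F', Q F' → F'.card ≤ F.card := by
    have hne : ({m | ∃ F, Q F ∧ F.card = m} : Set ℕ).Nonempty := ⟨0, ∅, ⟨by simp, by simp⟩, rfl⟩
    have hb : BddAbove ({m | ∃ F, Q F ∧ F.card = m} : Set ℕ) := by
      refine ⟨⌊M⌋₊, ?_⟩
      rintro m ⟨F, hF, rfl⟩
      exact hcard' F hF
    obtain ⟨F, hF, hFc⟩ := Nat.sSup_mem hne hb
    refine ⟨F, hF, fun F' hF' => ?_⟩
    rw [hFc]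
    exact le_csSup hb ⟨F', hF', rfl⟩
  refine ⟨F, fun a ha => ?_, hcard F hF⟩
  by_contra hcon
  simp only [Set.mem_iUnion, Metric.mem_closedBall, not_exists, not_le] at hcon
  have haF : a ∉ F := fun haF => by have := hcon a haF; simp at this; linarith
  have hQ : Q (insert a F) := by
    refine ⟨?_, ?_⟩
    · rw [Finset.coe_insert]; exact Set.insert_subset ha hF.1
    · intro x hx y hy hxy
      rw [Finset.mem_insert] at hx hy
      rcases hx with rfl | hx <;> rcases hy with rfl | hy
      · exact absurd rfl hxy
      · exact hcon y hy
      · rw [dist_comm]; exact hcon x hx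
      · exact hF.2 x hx y hy hxy
  have := hmax _ hQ
  rw [Finset.card_insert_of_notMem haF] at this
  omega


/-- The low-part integrand. -/
def lowf (γ κ : ℝ) (W : ℕ → E d → Ω → ℝ) (n : ℕ) (x : E d) (ω : Ω) : ENNReal :=
  if γ * n - W n x ω ≤ κ then
    ENNReal.ofReal ((1 + |γ * n - W n x ω|) * Real.exp (γ * W n x ω - γ ^ 2 / 2 * n)) else 0

def Low (γ κ : ℝ) (W : ℕ → E d → Ω → ℝ) (n : ℕ) (A : Set (E d)) (ω : Ω) : ENNReal :=
  ∫⁻ x in A, lowf γ κ W n x ω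

lemma W_joint (h : CritField P W K R L) (n : ℕ) : Measurable fun p : E d × Ω => W n p.1 p.2 :=
  measurable_uncurry_of_continuous_of_measurable (u := fun (z : E d) ω => W n z ω) (fun ω => h.cont n ω) (h.meas n)

lemma lowf_joint (h : CritField P W K R L) (γ κ : ℝ) (n : ℕ) :
    Measurable fun p : E d × Ω => lowf γ κ W n p.1 p.2 := by
  have hW := W_joint h n
  refine Measurable.ite (measurableSet_le (hW.const_sub _) measurable_const) ?_ measurable_const
  have : Measurable fun p : E d × Ω => |γ * n - W n p.1 p.2| :=
    (hW.const_sub (γ * n)).norm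
  exact ENNReal.measurable_ofReal.comp ((this.const_add 1).mul (Real.measurable_exp.comp ((hW.const_mul γ).sub_const _)))

lemma poly_le {b κ s : ℝ} (hb : 0 < b) (hκ : 0 ≤ κ) (hs : s ≤ κ) :
    1 + |s| ≤ (1 + κ + 1 / b) * Real.exp (b * κ) * Real.exp (-(b * s)) := by
  have h1 : |s| ≤ κ + (κ - s) := abs_le.2 ⟨by linarith, by linarith⟩
  rw [mul_assoc, ← Real.exp_add]
  have e : b * κ + -(b * s) = b * (κ - s) := by ring
  rw [e]
  have h2 := Real.add_one_le_exp (b * (κ - s))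
  have h0 : 0 ≤ b * (κ - s) := mul_nonneg hb.le (by linarith)
  have h3 : κ - s ≤ 1 / b * Real.exp (b * (κ - s)) := by
    rw [div_mul_eq_mul_div, le_div_iff₀ hb]; linarith
  have h4 : 1 + κ ≤ (1 + κ) * Real.exp (b * (κ - s)) := by
    have : 1 ≤ Real.exp (b * (κ - s)) := by linarith
    nlinarith
  linarith

/-- pointwise bound of `f / h`. -/
lemma ratio_le {γ κ : ℝ} (hγ : 0 < γ) (hκ : 0 ≤ κ) : ∃ C : ℝ, 0 ≤ C ∧ ∀ (n : ℕ) (w c : ℝ), γ * n - w ≤ κ →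
    (1 + |γ * n - w|) * Real.exp (γ * w - γ ^ 2 / 2 * n) *
      Real.exp (γ * (γ * n - c) + γ / 2 * |γ * n - c|) ≤
    C * (Real.exp (-(γ ^ 2 / 2 * n)) * Real.exp (5 * γ / 2 * w - 3 * γ / 2 * c))
      + C * (Real.exp (-(γ ^ 2 / 2 * n)) * Real.exp (3 * γ / 2 * w - γ / 2 * c)) := by
  set C1 := (1 + κ + 1 / (3 * γ / 2)) * Real.exp (3 * γ / 2 * κ) with hC1
  set C2 := (1 + κ + 1 / (γ / 2)) * Real.exp (γ / 2 * κ) with hC2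
  have h1 : 0 ≤ C1 := by positivity
  have h2 : 0 ≤ C2 := by positivity
  refine ⟨C1 + C2, by positivity, ?_⟩
  intro n w c hw
  set s := γ * n - w with hs
  set t := γ * n - c with ht
  have p1 := poly_le (by positivity : 0 < 3 * γ / 2) hκ hw
  have p2 := poly_le (by positivity : 0 < γ / 2) hκ hw
  rw [← hC1] at p1
  rw [← hC2] at p2
  have e0 : γ * w - γ ^ 2 / 2 * n = γ ^ 2 / 2 * n - γ * s := by rw [hs]; ring
  rw [e0]
  rcases le_total 0 t with h0 | h0
  · rw [abs_of_nonneg h0]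
    have e1 : Real.exp (-(γ ^ 2 / 2 * n)) * Real.exp (5 * γ / 2 * w - 3 * γ / 2 * c) =
        Real.exp (-(3 * γ / 2 * s)) * Real.exp (γ ^ 2 / 2 * n - γ * s) * Real.exp (γ * t + γ / 2 * t) := by
      rw [← Real.exp_add, ← Real.exp_add, ← Real.exp_add]; congr 1; rw [hs, ht]; ring
    rw [e1]
    have : (1 + |s|) * (Real.exp (γ ^ 2 / 2 * n - γ * s) * Real.exp (γ * t + γ / 2 * t)) ≤
      (C1 * Real.exp (-(3 * γ / 2 * s))) * (Real.exp (γ ^ 2 / 2 * n - γ * s) * Real.exp (γ * t + γ / 2 * t)) :=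
      mul_le_mul_of_nonneg_right p1 (by positivity)
    have q1 : 0 ≤ C2 * (Real.exp (-(3 * γ / 2 * s)) * Real.exp (γ ^ 2 / 2 * n - γ * s) * Real.exp (γ * t + γ / 2 * t)) := by positivity
    have q2 : 0 ≤ (C1 + C2) * (Real.exp (-(γ ^ 2 / 2 * n)) * Real.exp (3 * γ / 2 * w - γ / 2 * c)) := by positivity
    linarith
  · rw [abs_of_nonpos h0]
    have e1 : Real.exp (-(γ ^ 2 / 2 * n)) * Real.exp (3 * γ / 2 * w - γ / 2 * c) =
        Real.exp (-(γ / 2 * s)) * Real.exp (γ ^ 2 / 2 * n - γ * s) * Real.exp (γ * t + γ / 2 * -t) := by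
      rw [← Real.exp_add, ← Real.exp_add, ← Real.exp_add]; congr 1; rw [hs, ht]; ring
    rw [e1]
    have : (1 + |s|) * (Real.exp (γ ^ 2 / 2 * n - γ * s) * Real.exp (γ * t + γ / 2 * -t)) ≤
      (C2 * Real.exp (-(γ / 2 * s))) * (Real.exp (γ ^ 2 / 2 * n - γ * s) * Real.exp (γ * t + γ / 2 * -t)) :=
      mul_le_mul_of_nonneg_right p2 (by positivity)
    have q1 : 0 ≤ C1 * (Real.exp (-(γ / 2 * s)) * Real.exp (γ ^ 2 / 2 * n - γ * s) * Real.exp (γ * t + γ / 2 * -t)) := by positivity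
    have q2 : 0 ≤ (C1 + C2) * (Real.exp (-(γ ^ 2 / 2 * n)) * Real.exp (5 * γ / 2 * w - 3 * γ / 2 * c)) := by positivity
    linarith

lemma ratio_bound [IsProbabilityMeasure P] (h : CritField P W K R L) {γ κ : ℝ} (hγ : 0 < γ) (hκ : 0 ≤ κ) :
    ∃ C : ENNReal, C ≠ ⊤ ∧ ∀ (n : ℕ) (x c : E d), x ∈ Metric.closedBall c (Real.exp (-(n:ℝ))) →
      ∫⁻ ω, lowf γ κ W n x ω *
        ENNReal.ofReal (Real.exp (γ * (γ * n - W n c ω) + γ / 2 * |γ * n - W n c ω|)) ∂P ≤ C := by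
  obtain ⟨C, hC0, hC⟩ := ratio_le hγ hκ
  set D : ℝ := C * Real.exp (5 * γ / 2 * (3 * γ / 2) * L) + C * Real.exp (3 * γ / 2 * (γ / 2) * L) with hD
  refine ⟨ENNReal.ofReal D, ENNReal.ofReal_ne_top, fun n x c hx => ?_⟩
  have hWm := h.meas n x
  have hWc := h.meas n c
  have hxc : L * ‖x - c‖ * Real.exp n ≤ L := by
    rw [Metric.mem_closedBall, dist_eq_norm] at hx
    have : ‖x - c‖ * Real.exp n ≤ 1 := by
      have := mul_le_mul_of_nonneg_right hx (Real.exp_pos n).le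
      rwa [← Real.exp_add, neg_add_cancel, Real.exp_zero] at this
    have := mul_le_mul_of_nonneg_left this h.L0
    linarith
  have key : ∀ α β : ℝ, 0 ≤ α * β → α - β = γ →
      ∫⁻ ω, ENNReal.ofReal (C * (Real.exp (-(γ ^ 2 / 2 * n)) * Real.exp (α * W n x ω - β * W n c ω))) ∂P
        ≤ ENNReal.ofReal (C * Real.exp (α * β * L)) := by
    intro α β hαβ hsub
    simp_rw [← mul_assoc C]
    simp_rw [fun ω => ENNReal.ofReal_mul (p := C * Real.exp (-(γ ^ 2 / 2 * n))) (q := Real.exp (α * W n x ω - β * W n c ω)) (by positivity)]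
    rw [lintegral_const_mul _ (by fun_prop)]
    refine (mul_le_mul' le_rfl (exp_two h n x c hαβ)).trans ?_
    rw [← ENNReal.ofReal_mul (by positivity), mul_assoc, ← Real.exp_add]
    apply ENNReal.ofReal_le_ofReal
    refine mul_le_mul_of_nonneg_left (Real.exp_le_exp.2 ?_) hC0
    rw [hsub]
    have := mul_le_mul_of_nonneg_left hxc hαβ
    linarith
  calc _ ≤ ∫⁻ ω, (ENNReal.ofReal (C * (Real.exp (-(γ ^ 2 / 2 * n)) * Real.exp (5 * γ / 2 * W n x ω - 3 * γ / 2 * W n c ω)))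
        + ENNReal.ofReal (C * (Real.exp (-(γ ^ 2 / 2 * n)) * Real.exp (3 * γ / 2 * W n x ω - γ / 2 * W n c ω)))) ∂P := by
        apply lintegral_mono
        intro ω
        simp only [lowf]
        split_ifs with hω
        · rw [← ENNReal.ofReal_mul (by positivity), ← ENNReal.ofReal_add (by positivity) (by positivity)]
          exact ENNReal.ofReal_le_ofReal (hC n _ _ hω)
        · simp
    _ ≤ ENNReal.ofReal (C * Real.exp (5 * γ / 2 * (3 * γ / 2) * L)) + ENNReal.ofReal (C * Real.exp (3 * γ / 2 * (γ / 2) * L)) := by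
        rw [lintegral_add_left (by fun_prop)]
        exact add_le_add (key _ _ (by positivity) (by ring)) (key _ _ (by positivity) (by ring))
    _ = _ := by rw [hD, ENNReal.ofReal_add (by positivity) (by positivity)]

lemma ball_bound [IsProbabilityMeasure P] (h : CritField P W K R L) {γ κ : ℝ} (hγ : 0 < γ) (hκ : 0 ≤ κ) :
    ∃ C : ENNReal, C ≠ ⊤ ∧ ∀ (n : ℕ) (c : E d), 1 ≤ n →
      ∫⁻ ω, (Low γ κ W n (Metric.closedBall c (Real.exp (-(n:ℝ)))) ω) ^ (1 / 2 : ℝ) ∂P ≤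
       (C * volume (Metric.closedBall c (Real.exp (-(n:ℝ))))) ^ (1 / 2 : ℝ) *
        (ENNReal.ofReal ((Real.sqrt n)⁻¹ * Real.exp (-(γ ^ 2 / 2 * n))) * Cη (γ / 2)) ^ (1 / 2 : ℝ) := by
  obtain ⟨C, hC, hCb⟩ := ratio_bound h hγ hκ
  refine ⟨C, hC, fun n c hn => ?_⟩
  set B := Metric.closedBall c (Real.exp (-(n:ℝ))) with hB
  set H : Ω → ENNReal := fun ω => ENNReal.ofReal (Real.exp (-γ * (γ * n - W n c ω) - γ / 2 * |γ * n - W n c ω|)) with hH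
  set H' : Ω → ENNReal := fun ω => ENNReal.ofReal (Real.exp (γ * (γ * n - W n c ω) + γ / 2 * |γ * n - W n c ω|)) with hH'
  have hWc := h.meas n c
  have hHm : Measurable H := by fun_prop
  have hHm' : Measurable H' := by fun_prop
  have hHH : ∀ ω, H' ω * H ω = 1 := by
    intro ω
    simp only [hH, hH']
    rw [← ENNReal.ofReal_mul (Real.exp_pos _).le, ← Real.exp_add]
    ring_nf; simp
  have hJ := lowf_joint h γ κ n
  have hLm : Measurable (Low γ κ W n B) := hJ.lintegral_prod_left' (μ := volume.restrict B)
  have e1 : ∀ ω, (Low γ κ W n B ω) ^ (1 / 2 : ℝ) = (Low γ κ W n B ω * H' ω) ^ (1 / 2 : ℝ) * (H ω) ^ (1 / 2 : ℝ) := by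
    intro ω
    rw [← ENNReal.mul_rpow_of_nonneg _ _ (by norm_num), mul_assoc, hHH, mul_one]
  simp_rw [e1]
  have := ENNReal.lintegral_mul_le_Lp_mul_Lq P (p := 2) (q := 2) Real.HolderConjugate.two_two
    (f := fun ω => (Low γ κ W n B ω * H' ω) ^ (1 / 2 : ℝ)) (g := fun ω => (H ω) ^ (1 / 2 : ℝ))
    ((hLm.mul hHm').pow_const _).aemeasurable (hHm.pow_const _).aemeasurable
  refine this.trans ?_
  simp only [← ENNReal.rpow_mul]
  norm_num only [one_div, ENNReal.rpow_one]
  refine mul_le_mul' (ENNReal.rpow_le_rpow ?_ (by norm_num)) (ENNReal.rpow_le_rpow ?_ (by norm_num))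
  · have e2 : ∀ ω, Low γ κ W n B ω * H' ω = ∫⁻ x in B, lowf γ κ W n x ω * H' ω := by
      intro ω
      have hm : Measurable fun x => lowf γ κ W n x ω := hJ.comp measurable_prodMk_right
      rw [lintegral_mul_const _ hm, Low]
    simp_rw [e2]
    rw [lintegral_lintegral_swap (by exact ((hJ.mul (hHm'.comp measurable_snd)).comp measurable_swap).aemeasurable)]
    calc _ ≤ ∫⁻ x in B, C := setLIntegral_mono' measurableSet_closedBall fun x hx => hCb n x c hx
      _ = _ := by simp
  · exact h_bound h γ (γ / 2) n hn c

lemma sqrt_sum_le {ι : Type*} (s : Finset ι) (f : ι → ENNReal) :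
    (∑ i ∈ s, f i) ^ (1 / 2 : ℝ) ≤ ∑ i ∈ s, (f i) ^ (1 / 2 : ℝ) :=
  Finset.le_sum_of_subadditive (fun x : ENNReal => x ^ (1 / 2 : ℝ)) (by simp)
    (fun x y => ENNReal.rpow_add_le_add_rpow x y (by norm_num) (by norm_num)) s f

lemma lintegral_biUnion_finset_le' {α ι : Type*} [MeasurableSpace α] {μ : Measure α} (F : Finset ι)
    (t : ι → Set α) (f : α → ENNReal) :
    ∫⁻ x in ⋃ c ∈ F, t c, f x ∂μ ≤ ∑ c ∈ F, ∫⁻ x in t c, f x ∂μ := by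
  classical
  induction F using Finset.induction_on with
  | empty => simp
  | insert a F ha ih =>
    rw [Finset.set_biUnion_insert, Finset.sum_insert ha]
    exact (lintegral_union_le _ _ _).trans (add_le_add le_rfl ih)

lemma low_bound [IsProbabilityMeasure P] (h : CritField P W K R L) {γ κ : ℝ} (hγ : 0 < γ) (hγd : γ ^ 2 = 2 * d) (hκ : 0 ≤ κ)
    {A : Set (E d)} (hA : Bornology.IsBounded A) :
    ∃ C : ENNReal, C ≠ ⊤ ∧ ∀ (n : ℕ), 1 ≤ n →
      ∫⁻ ω, (Low γ κ W n A ω) ^ (1 / 2 : ℝ) ∂P ≤ C * (ENNReal.ofReal (Real.sqrt n)⁻¹) ^ (1 / 2 : ℝ) := by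
  obtain ⟨C, hC, hCb⟩ := ball_bound h hγ hκ
  obtain ⟨r0, hr0⟩ := hA.subset_closedBall (0 : E d)
  set r := max r0 0 with hr
  have hAr : A ⊆ Metric.closedBall 0 r := hr0.trans (Metric.closedBall_subset_closedBall (le_max_left _ _))
  have hrn : 0 ≤ r := le_max_right _ _
  set v : ENNReal := volume (Metric.ball (0 : E d) 1) with hv
  have hvt : v ≠ ⊤ := measure_ball_lt_top.ne
  have hJ := lowf_joint h γ κ
  refine ⟨ENNReal.ofReal ((2 * (r + 1)) ^ d) * ((C * v) ^ (1 / 2 : ℝ) * (Cη (γ / 2)) ^ (1 / 2 : ℝ)), ?_, fun n hn => ?_⟩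
  · refine ENNReal.mul_ne_top ENNReal.ofReal_ne_top (ENNReal.mul_ne_top ?_ ?_)
    · exact ENNReal.rpow_ne_top_of_nonneg (by norm_num) (ENNReal.mul_ne_top hC hvt)
    · exact ENNReal.rpow_ne_top_of_nonneg (by norm_num) (Cη_fin (by positivity))
  obtain ⟨F, hF, hFc⟩ := exists_cover hrn hAr n
  set s : ENNReal := ENNReal.ofReal (Real.exp (-(d * n : ℝ))) with hs
  have hsd : Real.exp (-(γ ^ 2 / 2 * n)) = Real.exp (-(d * n : ℝ)) := by rw [hγd]; congr 1; ring
  have hball : ∀ c : E d, ∫⁻ ω, (Low γ κ W n (Metric.closedBall c (Real.exp (-(n:ℝ)))) ω) ^ (1 / 2 : ℝ) ∂P ≤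
      s * ((C * v) ^ (1 / 2 : ℝ) * (Cη (γ / 2)) ^ (1 / 2 : ℝ)) * (ENNReal.ofReal (Real.sqrt n)⁻¹) ^ (1 / 2 : ℝ) := by
    intro c
    refine (hCb n c hn).trans_eq ?_
    have hvc : volume (Metric.closedBall c (Real.exp (-(n:ℝ)))) = s * v := by
      rw [Measure.addHaar_closedBall _ _ (Real.exp_pos _).le, finrank_euclideanSpace_fin, hs, ← Real.exp_nat_mul]
      congr 3; ring
    rw [hvc, hsd, ENNReal.ofReal_mul (by positivity), ← hs]
    have hss : s ^ (1 / 2 : ℝ) * s ^ (1 / 2 : ℝ) = s := by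
      rw [← ENNReal.rpow_add_of_nonneg _ _ (by norm_num) (by norm_num)]; norm_num
    simp only [ENNReal.mul_rpow_of_nonneg _ _ (by norm_num : (0:ℝ) ≤ 1 / 2)]
    calc _ = (s ^ (1 / 2 : ℝ) * s ^ (1 / 2 : ℝ)) * (C ^ (1 / 2 : ℝ) * v ^ (1 / 2 : ℝ) * Cη (γ / 2) ^ (1 / 2 : ℝ)) *
          ENNReal.ofReal (√↑n)⁻¹ ^ (1 / 2 : ℝ) := by ring
      _ = _ := by rw [hss]
  calc ∫⁻ ω, (Low γ κ W n A ω) ^ (1 / 2 : ℝ) ∂P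
      ≤ ∫⁻ ω, ∑ c ∈ F, (Low γ κ W n (Metric.closedBall c (Real.exp (-(n:ℝ)))) ω) ^ (1 / 2 : ℝ) ∂P := by
        apply lintegral_mono
        intro ω
        refine le_trans (ENNReal.rpow_le_rpow ?_ (by norm_num)) (sqrt_sum_le _ _)
        unfold Low
        refine (lintegral_mono_set hF).trans ?_
        exact lintegral_biUnion_finset_le' _ _ _
    _ = ∑ c ∈ F, ∫⁻ ω, (Low γ κ W n (Metric.closedBall c (Real.exp (-(n:ℝ)))) ω) ^ (1 / 2 : ℝ) ∂P := by
        rw [lintegral_finsetSum]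
        intro c _
        exact ((hJ n).lintegral_prod_left' (μ := volume.restrict _)).pow_const _
    _ ≤ ∑ c ∈ F, s * ((C * v) ^ (1 / 2 : ℝ) * (Cη (γ / 2)) ^ (1 / 2 : ℝ)) * (ENNReal.ofReal (Real.sqrt n)⁻¹) ^ (1 / 2 : ℝ) :=
        Finset.sum_le_sum fun c _ => hball c
    _ = (F.card * s) * (((C * v) ^ (1 / 2 : ℝ) * (Cη (γ / 2)) ^ (1 / 2 : ℝ)) * (ENNReal.ofReal (Real.sqrt n)⁻¹) ^ (1 / 2 : ℝ)) := by
        rw [Finset.sum_const, nsmul_eq_mul]; ring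
    _ ≤ ENNReal.ofReal ((2 * (r + 1)) ^ d) * (((C * v) ^ (1 / 2 : ℝ) * (Cη (γ / 2)) ^ (1 / 2 : ℝ)) * (ENNReal.ofReal (Real.sqrt n)⁻¹) ^ (1 / 2 : ℝ)) := by
        refine mul_le_mul' ?_ le_rfl
        rw [hs, ← ENNReal.ofReal_natCast, ← ENNReal.ofReal_mul (by positivity)]
        apply ENNReal.ofReal_le_ofReal
        have := mul_le_mul_of_nonneg_right hFc (Real.exp_pos (-(d * n : ℝ))).le
        rwa [mul_assoc _ (Real.exp _), ← Real.exp_add, add_neg_cancel, Real.exp_zero, mul_one] at this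
    _ = _ := by ring

lemma low_tendsto [IsProbabilityMeasure P] (h : CritField P W K R L) {γ κ : ℝ} (hγ : 0 < γ) (hγd : γ ^ 2 = 2 * d) (hκ : 0 ≤ κ)
    {A : Set (E d)} (hA : Bornology.IsBounded A) :
    Tendsto (fun n : ℕ => ∫⁻ ω, (Low γ κ W n A ω) ^ (1 / 2 : ℝ) ∂P) atTop (nhds 0) := by
  obtain ⟨C, hC, hb⟩ := low_bound h hγ hγd hκ hA
  have h1 : Tendsto (fun n : ℕ => C * (ENNReal.ofReal (Real.sqrt n)⁻¹) ^ (1 / 2 : ℝ)) atTop (nhds 0) := by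
    have h2 : Tendsto (fun n : ℕ => (Real.sqrt n)⁻¹) atTop (nhds 0) :=
      (Real.tendsto_sqrt_atTop.comp tendsto_natCast_atTop_atTop).inv_tendsto_atTop
    have h3 := ENNReal.tendsto_ofReal h2
    rw [ENNReal.ofReal_zero] at h3
    have h4 := (ENNReal.continuous_rpow_const (y := (1 / 2 : ℝ))).continuousAt.tendsto.comp h3
    have h5 := ENNReal.Tendsto.const_mul (a := C) h4 (Or.inr hC)
    simpa using! h5
  refine tendsto_of_tendsto_of_tendsto_of_le_of_le' tendsto_const_nhds h1 (Eventually.of_forall fun _ => zero_le) ?_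
  filter_upwards [eventually_ge_atTop 1] with n hn using hb n hn

end DerivMeas

namespace DerivMeas

set_option linter.unusedSectionVars false
set_option linter.unusedVariables false

variable {d : ℕ} {Ω : Type*} [m0 : MeasurableSpace Ω] {P : Measure Ω}
    {W : ℕ → E d → Ω → ℝ} {K : ℕ → E d → ℝ} {R L : ℝ}

/-- derivative martingale at integer times -/
def Dn (γ : ℝ) (W : ℕ → E d → Ω → ℝ) (n : ℕ) (A : Set (E d)) (ω : Ω) : ℝ :=
  ∫ x in A, (γ * n - W n x ω) * Real.exp (γ * W n x ω - γ ^ 2 / 2 * n)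

lemma pos_le (h : CritField P W K R L) {γ κ : ℝ} (hκ : 0 ≤ κ) (n : ℕ) {A : Set (E d)}
    (hA : Bornology.IsBounded A) (ω : Ω) (hL : Low γ κ W n A ω ≠ ⊤) :
    ∫⁻ x in A, ENNReal.ofReal ((γ * n - W n x ω) * Real.exp (γ * W n x ω - γ ^ 2 / 2 * n)) ≤
      ENNReal.ofReal (Dn γ W n A ω) + Low γ κ W n A ω := by
  have hW := h.cont n ω
  have hc : Continuous fun x => (γ * n - W n x ω) * Real.exp (γ * W n x ω - γ ^ 2 / 2 * n) := by
    fun_prop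
  have hi : IntegrableOn (fun x => (γ * n - W n x ω) * Real.exp (γ * W n x ω - γ ^ 2 / 2 * n)) A :=
    (hc.continuousOn.integrableOn_compact hA.isCompact_closure).mono_set subset_closure
  have e := integral_eq_lintegral_pos_part_sub_lintegral_neg_part hi
  change Dn γ W n A ω = _ at e
  set p := ∫⁻ x in A, ENNReal.ofReal ((γ * n - W n x ω) * Real.exp (γ * W n x ω - γ ^ 2 / 2 * n)) with hp
  set q := ∫⁻ x in A, ENNReal.ofReal (-((γ * n - W n x ω) * Real.exp (γ * W n x ω - γ ^ 2 / 2 * n))) with hq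
  have hql : q ≤ Low γ κ W n A ω := by
    apply lintegral_mono
    intro x
    simp only [lowf]
    split_ifs with hx
    · apply ENNReal.ofReal_le_ofReal
      rw [← neg_mul]
      apply mul_le_mul_of_nonneg_right _ (Real.exp_pos _).le
      linarith [neg_abs_le (γ * n - W n x ω)]
    · rw [ENNReal.ofReal_of_nonpos]
      have : 0 ≤ γ * n - W n x ω := by linarith
      have := mul_nonneg this (Real.exp_pos (γ * W n x ω - γ ^ 2 / 2 * n)).le
      linarith
  have hpf : p ≠ ⊤ := by
    have := hi.lintegral_lt_top
    exact this.ne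
  have hqf : q ≠ ⊤ := ne_top_of_le_ne_top hL hql
  calc p = ENNReal.ofReal (p.toReal) := (ENNReal.ofReal_toReal hpf).symm
    _ = ENNReal.ofReal (Dn γ W n A ω + q.toReal) := by rw [e]; congr 1; ring
    _ ≤ ENNReal.ofReal (Dn γ W n A ω) + ENNReal.ofReal q.toReal := ENNReal.ofReal_add_le
    _ ≤ _ := by rw [ENNReal.ofReal_toReal hqf]; gcongr

lemma Vt_le (h : CritField P W K R L) {γ κ C : ℝ} (hκ : 0 < κ) (hC : 0 ≤ C) (T j : ℕ) {A B : Set (E d)}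
    (hA : Bornology.IsBounded A) (hAm : MeasurableSet A) (hBA : B ⊆ A) (ω : Ω) (hL : Low γ κ W (T + j) A ω ≠ ⊤)
    (hCb : ∀ x ∈ A, |γ * T - W T x ω| ≤ C) :
    Vt γ W T j B ω ≤ ENNReal.ofReal (1 + C / κ) * (ENNReal.ofReal (Dn γ W (T + j) A ω) + Low γ κ W (T + j) A ω)
      + ENNReal.ofReal C * Low γ κ W (T + j) A ω := by
  have hW := h.cont (T + j) ω
  have hm1 : Measurable fun x => ENNReal.ofReal ((γ * (T + j : ℕ) - W (T + j) x ω) * Real.exp (γ * W (T + j) x ω - γ ^ 2 / 2 * (T + j : ℕ))) := by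
    apply ENNReal.measurable_ofReal.comp
    apply Continuous.measurable
    fun_prop
  have hm2 : Measurable fun x => lowf γ κ W (T + j) x ω := (lowf_joint h γ κ (T + j)).comp measurable_prodMk_right
  calc Vt γ W T j B ω ≤ ∫⁻ x in A, ENNReal.ofReal (Real.exp (γ * W T x ω - γ ^ 2 / 2 * T)) * Wt γ W T j x ω :=
        lintegral_mono_set hBA
    _ ≤ ∫⁻ x in A, (ENNReal.ofReal (1 + C / κ) * ENNReal.ofReal ((γ * (T + j : ℕ) - W (T + j) x ω) * Real.exp (γ * W (T + j) x ω - γ ^ 2 / 2 * (T + j : ℕ))) + ENNReal.ofReal C * lowf γ κ W (T + j) x ω) := by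
        apply setLIntegral_mono' hAm
        intro x hx
        set s := γ * (T + j : ℕ) - W (T + j) x ω with hs
        set e := Real.exp (γ * W (T + j) x ω - γ ^ 2 / 2 * (T + j : ℕ)) with he
        have he0 : 0 < e := Real.exp_pos _
        have h1 : ENNReal.ofReal (Real.exp (γ * W T x ω - γ ^ 2 / 2 * T)) * V γ W T j x ω ≤ ENNReal.ofReal e := by
          refine (mul_le_mul' le_rfl (V_le γ T j x ω)).trans_eq ?_
          rw [← ENNReal.ofReal_mul (Real.exp_pos _).le, ← Real.exp_add, he]
          congr 2
          simp only [inc]; push_cast; ring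
        have hSs : S γ W T j x ω ≤ s + C := by
          have := (abs_le.1 (hCb x hx)).1
          simp only [S, inc, hs]; push_cast; nlinarith
        have h2 : ENNReal.ofReal (Real.exp (γ * W T x ω - γ ^ 2 / 2 * T)) * Wt γ W T j x ω ≤ ENNReal.ofReal (s * e + C * e) := by
          rw [Wt, ← mul_assoc]
          refine (mul_le_mul' h1 (ENNReal.ofReal_le_ofReal hSs)).trans_eq ?_
          rw [← ENNReal.ofReal_mul he0.le]
          congr 1; ring
        refine h2.trans (ENNReal.ofReal_add_le.trans ?_)
        by_cases hsk : s ≤ κ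
        · have hl : lowf γ κ W (T + j) x ω = ENNReal.ofReal ((1 + |s|) * e) := by
            simp only [lowf]; rw [if_pos hsk]
          apply add_le_add
          · conv_lhs => rw [← one_mul (ENNReal.ofReal (s * e))]
            refine mul_le_mul' ?_ le_rfl
            rw [← ENNReal.ofReal_one]
            apply ENNReal.ofReal_le_ofReal
            have : 0 ≤ C / κ := by positivity
            linarith
          · rw [hl, ← ENNReal.ofReal_mul hC]
            apply ENNReal.ofReal_le_ofReal
            apply mul_le_mul_of_nonneg_left _ hC
            nlinarith [abs_nonneg s]
        · push Not at hsk
          have hs0 : 0 ≤ s := by linarith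
          refine le_trans ?_ (le_add_of_nonneg_right zero_le)
          rw [← ENNReal.ofReal_mul (by positivity), ← ENNReal.ofReal_add (by positivity) (by positivity)]
          apply ENNReal.ofReal_le_ofReal
          have : C ≤ C / κ * s := by
            rw [div_mul_eq_mul_div, le_div_iff₀ hκ]; nlinarith
          nlinarith
    _ = ENNReal.ofReal (1 + C / κ) * (∫⁻ x in A, ENNReal.ofReal ((γ * (T + j : ℕ) - W (T + j) x ω) * Real.exp (γ * W (T + j) x ω - γ ^ 2 / 2 * (T + j : ℕ)))) + ENNReal.ofReal C * Low γ κ W (T + j) A ω := by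
        rw [lintegral_add_left (hm1.const_mul _), lintegral_const_mul _ hm1, lintegral_const_mul _ hm2, Low]
    _ ≤ _ := by
        gcongr
        exact pos_le h hκ.le (T + j) hA ω hL

lemma exists_seq [IsProbabilityMeasure P] (h : CritField P W K R L) {γ : ℝ} (hγ : 0 < γ) (hγd : γ ^ 2 = 2 * d)
    {A : Set (E d)} (hA : Bornology.IsBounded A) :
    ∃ N : ℕ → ℕ, (∀ k, k ≤ N k) ∧ ∀ᵐ ω ∂P, Tendsto (fun k : ℕ => Low γ ((k:ℝ) + 1) W (N k) A ω) atTop (nhds 0) := by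
  have h1 : ∀ k : ℕ, ∃ n, k ≤ n ∧ ∫⁻ ω, (Low γ ((k:ℝ) + 1) W n A ω) ^ (1 / 2 : ℝ) ∂P < (2⁻¹ : ENNReal) ^ k := by
    intro k
    have ht := low_tendsto h hγ hγd (κ := (k:ℝ) + 1) (by positivity) hA
    have hp : (0 : ENNReal) < (2⁻¹ : ENNReal) ^ k := by
      apply ENNReal.pow_pos; simp
    exact ((eventually_ge_atTop k).and (ht.eventually_lt_const hp)).exists
  choose N hN hNb using h1
  refine ⟨N, hN, ?_⟩
  have hm : ∀ k : ℕ, Measurable fun ω => (Low γ ((k:ℝ) + 1) W (N k) A ω) ^ (1 / 2 : ℝ) := fun k =>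
    ((lowf_joint h γ _ (N k)).lintegral_prod_left' (μ := volume.restrict _)).pow_const _
  have hs : ∫⁻ ω, ∑' k : ℕ, (Low γ ((k:ℝ) + 1) W (N k) A ω) ^ (1 / 2 : ℝ) ∂P ≠ ⊤ := by
    rw [lintegral_tsum fun k => (hm k).aemeasurable]
    refine ne_top_of_le_ne_top ?_ (ENNReal.tsum_le_tsum fun k => (hNb k).le)
    rw [ENNReal.tsum_geometric]
    simp
  filter_upwards [ae_lt_top (Measurable.tsum hm) hs] with ω hω
  have ht := ENNReal.tendsto_atTop_zero_of_tsum_ne_top hω.ne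
  have := ((ENNReal.continuous_rpow_const (y := 2)).tendsto (0:ENNReal)).comp ht
  simp only [Function.comp_def, ← ENNReal.rpow_mul] at this
  norm_num at this
  exact this

lemma prob_bound [IsProbabilityMeasure P] (hd : 1 ≤ d) (h : CritField P W K R L) {γ : ℝ} (hγ : 0 < γ) (hγd : γ ^ 2 = 2 * d)
    {A : Set (E d)} (hA : Bornology.IsBounded A) (hAo : IsOpen A) (hAn : A.Nonempty) {M : Ω → ℝ}
    (hM : ∀ᵐ ω ∂P, Tendsto (fun n => Dn γ W n A ω) atTop (nhds (M ω))) :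
    ∃ ρ : ENNReal, ρ < 1 ∧ ∃ l > 0, ∃ r > 0, ∀ (T : ℕ) (a : ℝ), 0 ≤ a →
      P {ω | M ω < l * Real.exp (-((γ * a + γ ^ 2) * T))} ≤
        ρ ^ ⌊r * Real.exp T⌋₊ + 2 * ENNReal.ofReal (Real.exp (-(a ^ 2 * T / 2))) := by
  obtain ⟨ρ, hρ, l, hl, hb⟩ := total_prob hd h hγ hγd
  obtain ⟨x0, hx0⟩ := hAn
  obtain ⟨r, hr, hrA⟩ := Metric.isOpen_iff.1 hAo x0 hx0
  have hR := h.R2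
  refine ⟨ρ, hρ, l, hl, r / (R + 3), by positivity, fun T a ha => ?_⟩
  obtain ⟨B, hB, hBm, hbb⟩ := hb T x0 r hr
  obtain ⟨N, hN, hNl⟩ := exists_seq h hγ hγd hA
  set ε := l * Real.exp (-((γ * a + γ ^ 2) * T)) with hε
  have hε0 : 0 < ε := by positivity
  set G : ℕ → Set Ω := fun k => {ω | Vt γ W T (N k - T) B ω < ENNReal.ofReal ε} with hG
  set b := ρ ^ ⌊r / (R + 3) * Real.exp T⌋₊ + 2 * ENNReal.ofReal (Real.exp (-(a ^ 2 * T / 2))) with hbd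
  have hGb : ∀ k, T + 1 ≤ k → P (G k) ≤ b := by
    intro k hk
    have := hbb (N k - T) (by have := hN k; omega) a ha
    rwa [mul_div_right_comm] at this
  have hsub : {ω | M ω < ε} ≤ᵐ[P] ⋃ m : ℕ, ⋂ k ∈ Set.Ici m, G k := by
    filter_upwards [hM, hNl] with ω hMω hLω hω
    have hω' : M ω < ε := hω
    have hNt : Tendsto N atTop atTop := tendsto_atTop_mono hN tendsto_id
    obtain ⟨C0, hC0⟩ := (hA.isCompact_closure).exists_bound_of_continuousOn
      (f := fun x => γ * T - W T x ω) (continuous_const.sub (h.cont T ω)).continuousOn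
    set C := max C0 0
    have hC : ∀ x ∈ A, |γ * T - W T x ω| ≤ C := fun x hx =>
      (hC0 x (subset_closure hx)).trans (le_max_left _ _)
    have hDt : Tendsto (fun k => ENNReal.ofReal (Dn γ W (N k) A ω)) atTop (nhds (ENNReal.ofReal (M ω))) :=
      (ENNReal.continuous_ofReal.tendsto _).comp (hMω.comp hNt)
    have hκ : Tendsto (fun k : ℕ => ENNReal.ofReal (1 + C / ((k:ℝ) + 1))) atTop (nhds 1) := by
      have : Tendsto (fun k : ℕ => 1 + C / ((k:ℝ) + 1)) atTop (nhds (1 + 0)) := by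
        apply Tendsto.const_add
        exact tendsto_const_nhds.div_atTop (tendsto_atTop_add_const_right _ _ tendsto_natCast_atTop_atTop)
      have := (ENNReal.continuous_ofReal.tendsto _).comp this
      simpa [Function.comp_def] using this
    have hlim : Tendsto (fun k : ℕ => ENNReal.ofReal (1 + C / ((k:ℝ) + 1)) * (ENNReal.ofReal (Dn γ W (N k) A ω) + Low γ ((k:ℝ) + 1) W (N k) A ω)
      + ENNReal.ofReal C * Low γ ((k:ℝ) + 1) W (N k) A ω) atTop (nhds (1 * (ENNReal.ofReal (M ω) + 0) + ENNReal.ofReal C * 0)) := by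
      apply Tendsto.add
      · apply ENNReal.Tendsto.mul hκ (Or.inl one_ne_zero) (hDt.add hLω) (Or.inr ENNReal.one_ne_top)
      · exact ENNReal.Tendsto.const_mul hLω (Or.inr ENNReal.ofReal_ne_top)
    have hlt : 1 * (ENNReal.ofReal (M ω) + 0) + ENNReal.ofReal C * 0 < ENNReal.ofReal ε := by
      simp [ENNReal.ofReal_lt_ofReal_iff hε0, hω']
    have hev := (hlim.eventually_lt_const hlt).and
      ((hLω.eventually_lt_const (ENNReal.zero_lt_top)).and (eventually_ge_atTop T))
    obtain ⟨m, hm⟩ := eventually_atTop.1 hev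
    refine Set.mem_iUnion.2 ⟨m, Set.mem_iInter₂.2 fun k hk => ?_⟩
    obtain ⟨h1, h2, h3⟩ := hm k hk
    have hNk : T + (N k - T) = N k := by have := hN k; omega
    have := Vt_le h (γ := γ) (κ := (k:ℝ) + 1) (C := C) (by positivity) (le_max_right _ _) T (N k - T) hA hAo.measurableSet
      (hB.trans hrA) ω (by rw [hNk]; exact h2.ne) hC
    rw [hNk] at this
    exact this.trans_lt h1
  refine (measure_mono_ae hsub).trans ?_
  rw [Monotone.measure_iUnion]
  · refine iSup_le fun m => ?_
    refine le_trans (measure_mono ?_) (hGb (max m (T + 1)) (le_max_right _ _))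
    exact Set.biInter_subset_of_mem (le_max_left m (T+1))
  · intro m m' hmm
    exact Set.biInter_subset_biInter_left (Set.Ici_subset_Ici.2 hmm)

lemma exists_level {γ q r : ℝ} (hγ : 0 < γ) (hq : 0 < q) (hr : 0 < r) {ρ : ENNReal} (hρ : ρ < 1) :
    ∃ a : ℝ, 0 ≤ a ∧ ∃ T0 : ℕ, ∀ T : ℕ, T0 ≤ T →
      ρ ^ ⌊r * Real.exp T⌋₊ + 2 * ENNReal.ofReal (Real.exp (-(a ^ 2 * T / 2))) ≤
        3 * ENNReal.ofReal (Real.exp (-(((γ * a + γ ^ 2) * q + 1) * T))) := by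
  set a := 2 * (γ * q + γ ^ 2 * q + 1) with ha
  have hgq : 0 < γ * q := by positivity
  have hgq2 : 0 < γ ^ 2 * q := by positivity
  have ha0 : 0 ≤ a := by positivity
  set D := (γ * a + γ ^ 2) * q + 1 with hD
  have haD : D ≤ a ^ 2 / 2 := by
    have : a ^ 2 / 2 = a * (γ * q + γ ^ 2 * q + 1) := by rw [ha]; ring
    rw [this, hD]
    nlinarith
  obtain ⟨p, hp⟩ : ∃ p : ℕ, ρ ^ p < ENNReal.ofReal (Real.exp (-D)) := by
    have := ENNReal.tendsto_pow_atTop_nhds_zero_of_lt_one hρ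
    exact (this.eventually_lt_const (ENNReal.ofReal_pos.2 (Real.exp_pos _))).exists
  have hev : ∀ᶠ T : ℕ in atTop, (p * T : ℝ) ≤ r * Real.exp T := by
    have h1 := (Real.tendsto_exp_div_pow_atTop 1).comp tendsto_natCast_atTop_atTop
    have h2 := h1.eventually_ge_atTop ((p:ℝ) / r)
    filter_upwards [h2, eventually_gt_atTop 0] with T hT hT0
    have hT0' : (0:ℝ) < T := by exact_mod_cast hT0
    simp only [Function.comp_apply, pow_one] at hT
    rw [div_le_div_iff₀ hr hT0'] at hT
    linarith
  obtain ⟨T0, hT0⟩ := eventually_atTop.1 hev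
  refine ⟨a, ha0, T0, fun T hT => ?_⟩
  have h1 : ρ ^ ⌊r * Real.exp T⌋₊ ≤ ENNReal.ofReal (Real.exp (-(D * T))) := by
    have : p * T ≤ ⌊r * Real.exp T⌋₊ := Nat.le_floor (by push_cast; exact hT0 T hT)
    refine (pow_le_pow_right_of_le_one' hρ.le this).trans ?_
    rw [pow_mul]
    refine (pow_le_pow_left' hp.le T).trans_eq ?_
    rw [← ENNReal.ofReal_pow (Real.exp_pos _).le, ← Real.exp_nat_mul]
    congr 2; ring
  have h2 : ENNReal.ofReal (Real.exp (-(a ^ 2 * T / 2))) ≤ ENNReal.ofReal (Real.exp (-(D * T))) := by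
    apply ENNReal.ofReal_le_ofReal
    apply Real.exp_le_exp.2
    have : (0:ℝ) ≤ T := by positivity
    nlinarith
  calc _ ≤ ENNReal.ofReal (Real.exp (-(D * T))) + 2 * ENNReal.ofReal (Real.exp (-(D * T))) := by gcongr
    _ = _ := by ring

lemma moments {M : Ω → ℝ} [IsProbabilityMeasure P] {l c q : ℝ} (hl : 0 < l) (hc : 0 < c) (hq : 0 < q) (T0 : ℕ)
    (hb : ∀ T : ℕ, T0 ≤ T → P {ω | M ω < l * Real.exp (-(c * T))} ≤
      3 * ENNReal.ofReal (Real.exp (-((c * q + 1) * T)))) :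
    (∀ᵐ ω ∂P, 0 < M ω) ∧ ∫⁻ ω, ENNReal.ofReal (M ω ^ (-q)) ∂P < ⊤ := by
  set ε : ℕ → ℝ := fun T => l * Real.exp (-(c * T)) with hε
  have hε0 : ∀ T, 0 < ε T := fun T => by positivity
  have hpos : ∀ᵐ ω ∂P, 0 < M ω := by
    rw [ae_iff]
    have ht : Tendsto (fun T : ℕ => 3 * ENNReal.ofReal (Real.exp (-((c * q + 1) * T)))) atTop (nhds (3 * 0)) := by
      apply ENNReal.Tendsto.const_mul _ (Or.inr (by norm_num))
      have h1 : Tendsto (fun T : ℕ => Real.exp (-((c * q + 1) * T))) atTop (nhds 0) := by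
        apply Real.tendsto_exp_neg_atTop_nhds_zero.comp
        exact Tendsto.const_mul_atTop (by positivity) tendsto_natCast_atTop_atTop
      simpa [Function.comp_def] using (ENNReal.continuous_ofReal.tendsto _).comp h1
    rw [mul_zero] at ht
    refine le_antisymm (ge_of_tendsto ht ?_) zero_le
    filter_upwards [eventually_ge_atTop T0] with T hT
    refine (measure_mono ?_).trans (hb T hT)
    intro ω hω
    have : ¬ 0 < M ω := hω
    show M ω < ε T
    linarith [hε0 T]
  refine ⟨hpos, ?_⟩
  set G : ℕ → Set Ω := fun T => toMeasurable P {ω | M ω < ε T} with hG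
  have hGm : ∀ T, MeasurableSet (G T) := fun T => measurableSet_toMeasurable _ _
  have hlim : Tendsto ε atTop (nhds 0) := by
    have h1 : Tendsto (fun T : ℕ => Real.exp (-(c * T))) atTop (nhds 0) := by
      apply Real.tendsto_exp_neg_atTop_nhds_zero.comp
      exact Tendsto.const_mul_atTop (by positivity) tendsto_natCast_atTop_atTop
    simpa using h1.const_mul l
  have hpt : ∀ᵐ ω ∂P, ENNReal.ofReal (M ω ^ (-q)) ≤ ENNReal.ofReal (ε T0 ^ (-q)) +
      ∑' T : ℕ, (G (T0 + T)).indicator (fun _ => ENNReal.ofReal (ε (T0 + T + 1) ^ (-q))) ω := by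
    filter_upwards [hpos] with ω hω
    by_cases h0 : ε T0 ≤ M ω
    · refine le_trans (ENNReal.ofReal_le_ofReal ?_) (le_add_of_nonneg_right zero_le)
      exact Real.rpow_le_rpow_of_nonpos (hε0 _) h0 (by linarith)
    · have hex : ∃ T, ε (T0 + T) ≤ M ω := by
        have : Tendsto (fun T => ε (T0 + T)) atTop (nhds 0) :=
          hlim.comp (tendsto_atTop_mono (fun T => Nat.le_add_left T T0) tendsto_id)
        exact (this.eventually_le_const hω).exists
      classical
      set T1 := Nat.find hex with hT1
      have hs := Nat.find_spec hex
      have hT1pos : T1 ≠ 0 := by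
        intro h; rw [← hT1, h] at hs; exact h0 hs
      obtain ⟨T2, hT2⟩ := Nat.exists_eq_succ_of_ne_zero hT1pos
      have hmin : ¬ ε (T0 + T2) ≤ M ω := Nat.find_min hex (by omega)
      rw [← hT1, hT2] at hs
      refine le_trans ?_ (le_add_of_nonneg_left zero_le)
      refine le_trans ?_ (ENNReal.le_tsum T2)
      rw [Set.indicator_of_mem (subset_toMeasurable _ _ (by exact not_le.1 hmin))]
      apply ENNReal.ofReal_le_ofReal
      exact Real.rpow_le_rpow_of_nonpos (hε0 _) hs (by linarith)
  refine (lintegral_mono_ae hpt).trans_lt ?_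
  rw [lintegral_add_left measurable_const, lintegral_const, measure_univ, mul_one,
    lintegral_tsum fun T => (measurable_const.indicator (hGm _)).aemeasurable]
  refine ENNReal.add_lt_top.2 ⟨ENNReal.ofReal_lt_top, ?_⟩
  have hterm : ∀ T : ℕ, ∫⁻ ω, (G (T0 + T)).indicator (fun _ => ENNReal.ofReal (ε (T0 + T + 1) ^ (-q))) ω ∂P ≤
      (3 * ENNReal.ofReal (l ^ (-q) * Real.exp (c * q))) * (ENNReal.ofReal (Real.exp (-1))) ^ T := by
    intro T
    rw [lintegral_indicator_const (hGm _), hG]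
    simp only [measure_toMeasurable]
    refine (mul_le_mul' le_rfl (hb (T0 + T) (Nat.le_add_right _ _))).trans ?_
    rw [mul_left_comm, mul_assoc, ← ENNReal.ofReal_pow (Real.exp_pos _).le, ← ENNReal.ofReal_mul (by positivity),
      ← ENNReal.ofReal_mul (by positivity)]
    refine mul_le_mul' le_rfl (ENNReal.ofReal_le_ofReal ?_)
    rw [hε]
    simp only
    rw [Real.mul_rpow hl.le (Real.exp_pos _).le, ← Real.exp_mul, mul_assoc, ← Real.exp_add, mul_assoc,
      ← Real.exp_nat_mul, ← Real.exp_add]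
    apply mul_le_mul_of_nonneg_left _ (Real.rpow_pos_of_pos hl _).le
    apply Real.exp_le_exp.2
    push_cast
    have : (0:ℝ) ≤ T0 := by positivity
    nlinarith
  refine (ENNReal.tsum_le_tsum hterm).trans_lt ?_
  rw [ENNReal.tsum_mul_left, ENNReal.tsum_geometric]
  refine ENNReal.mul_lt_top (ENNReal.mul_lt_top (by norm_num) ENNReal.ofReal_lt_top) ?_
  rw [ENNReal.inv_lt_top]
  refine tsub_pos_of_lt ?_
  rw [← ENNReal.ofReal_one]
  exact (ENNReal.ofReal_lt_ofReal_iff one_pos).2 (by rw [Real.exp_lt_one_iff]; norm_num)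

theorem main_field [IsProbabilityMeasure P] (hd : 1 ≤ d) (h : CritField P W K R L) {γ : ℝ} (hγ : 0 < γ) (hγd : γ ^ 2 = 2 * d)
    {A : Set (E d)} (hA : Bornology.IsBounded A) (hAo : IsOpen A) (hAn : A.Nonempty) {M : Ω → ℝ}
    (hM : ∀ᵐ ω ∂P, Tendsto (fun n => Dn γ W n A ω) atTop (nhds (M ω))) {q : ℝ} (hq : 0 < q) :
    (∀ᵐ ω ∂P, 0 < M ω) ∧ ∫⁻ ω, ENNReal.ofReal (M ω ^ (-q)) ∂P < ⊤ := by
  obtain ⟨ρ, hρ, l, hl, r, hr, hb⟩ := prob_bound hd h hγ hγd hA hAo hAn hM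
  obtain ⟨a, ha, T0, hT⟩ := exists_level hγ hq hr hρ
  exact moments hl (c := γ * a + γ ^ 2) (by positivity) hq T0 fun T hTT => (hb T a ha).trans (hT T hTT)

end DerivMeas

namespace DerivMeas

set_option linter.unusedSectionVars false
set_option linter.unusedVariables false

/-- the covariance kernel at integer times -/
def KK {d : ℕ} (k : E d → ℝ) (n : ℕ) (z : E d) : ℝ := ∫ u in Set.Icc (1:ℝ) (Real.exp n), k (u • z) / u

lemma KK_int {d : ℕ} {k : E d → ℝ} (hk : Continuous k) (n : ℕ) (z : E d) :
    IntegrableOn (fun u : ℝ => k (u • z) / u) (Set.Icc (1:ℝ) (Real.exp n)) := by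
  refine ContinuousOn.integrableOn_compact isCompact_Icc ?_
  refine ContinuousOn.div (f := fun u : ℝ => k (u • z)) (g := fun u : ℝ => u) ?_ ?_ ?_
  · fun_prop
  · fun_prop
  · intro u hu
    have := hu.1
    positivity

lemma one_le_exp_nat (n : ℕ) : (1:ℝ) ≤ Real.exp n := Real.one_le_exp (by positivity)

lemma KK_zero {d : ℕ} {k : E d → ℝ} (hk0 : k 0 = 1) (n : ℕ) : KK k n 0 = n := by
  simp only [KK, smul_zero, hk0]
  rw [integral_Icc_eq_integral_Ioc, ← intervalIntegral.integral_of_le (one_le_exp_nat n),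
    integral_one_div_of_pos one_pos (Real.exp_pos _)]
  simp

lemma KK_sep {d : ℕ} {k : E d → ℝ} {R : ℝ} (hR0 : 0 ≤ R) (hR : ∀ z, R ≤ ‖z‖ → k z = 0) (m n : ℕ) (z : E d)
    (hmn : m ≤ n) (hz : R * Real.exp (-(m:ℝ)) ≤ ‖z‖) : KK k n z = KK k m z := by
  unfold KK
  apply setIntegral_eq_of_subset_of_forall_sdiff_eq_zero measurableSet_Icc
  · apply Set.Icc_subset_Icc_right
    apply Real.exp_le_exp.2
    exact_mod_cast hmn
  · intro u hu
    have h1 := hu.1.1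
    have h2 : Real.exp m < u := by
      by_contra hc
      exact hu.2 ⟨h1, not_lt.1 hc⟩
    rw [hR, zero_div]
    rw [norm_smul, Real.norm_of_nonneg (by linarith)]
    have h3 : Real.exp m * (R * Real.exp (-(m:ℝ))) ≤ u * ‖z‖ := mul_le_mul h2.le hz (by positivity) (by linarith)
    have h4 : Real.exp m * (R * Real.exp (-(m:ℝ))) = R := by
      rw [mul_left_comm, ← Real.exp_add]; simp
    linarith

lemma KK_close {d : ℕ} {k : E d → ℝ} (hk0 : k 0 = 1) {L : NNReal} (hL : LipschitzWith L k) (n : ℕ) (z : E d) :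
    (n:ℝ) - KK k n z ≤ L * ‖z‖ * Real.exp n := by
  have e0 : (n:ℝ) - KK k n z = KK k n 0 - KK k n z := by rw [KK_zero hk0 n]
  rw [e0]
  unfold KK
  rw [← integral_sub (KK_int hL.continuous n 0) (KK_int hL.continuous n z)]
  have h1 : ∫ u in Set.Icc (1:ℝ) (Real.exp n), (k (u • 0) / u - k (u • z) / u) ≤
      ∫ u in Set.Icc (1:ℝ) (Real.exp n), (L * ‖z‖ : ℝ) := by
    apply setIntegral_mono_on ((KK_int hL.continuous n 0).sub (KK_int hL.continuous n z)) _ measurableSet_Icc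
    · intro u hu
      have hu0 : 0 < u := by linarith [hu.1]
      change k (u • 0) / u - k (u • z) / u ≤ L * ‖z‖
      rw [← sub_div, div_le_iff₀ hu0]
      have := hL.dist_le_mul (u • 0) (u • z)
      rw [Real.dist_eq, dist_eq_norm, ← smul_sub, norm_smul, Real.norm_of_nonneg hu0.le, zero_sub, norm_neg] at this
      have h2 := le_abs_self (k (u • 0) - k (u • z))
      nlinarith
    · exact (integrable_const _)
  refine h1.trans ?_
  rw [setIntegral_const, Measure.real, Real.volume_Icc, ENNReal.toReal_ofReal (by linarith [one_le_exp_nat n]), smul_eq_mul]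
  have : 0 ≤ L * ‖z‖ := by positivity
  nlinarith

variable {d : ℕ} {Ω : Type*} [m0 : MeasurableSpace Ω] {P : Measure Ω}

lemma gauss_of {X : ℝ → E d → Ω → ℝ} (hXmeas : ∀ t x, Measurable (X t x))
    (hXgauss : ∀ (n : ℕ) (c : Fin n → ℝ) (t : Fin n → ℝ) (x : Fin n → E d),
      ∃ v : NNReal, Measure.map (fun ω => ∑ i, c i * X (t i) (x i) ω) P = gaussianReal 0 v) :
    IsGaussianProcess (fun p : ℝ × E d => X p.1 p.2) P := by
  classical
  refine ⟨fun I => ⟨isGaussian_of_map_eq_gaussianReal fun Λ => ?_⟩⟩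
  have hm : Measurable (fun ω => I.restrict (fun p : ℝ × E d => X p.1 p.2 ω)) :=
    measurable_pi_lambda _ fun i => hXmeas _ _
  rw [Measure.map_map (by fun_prop) hm]
  let e := Fintype.equivFin I
  obtain ⟨v, hv⟩ := hXgauss (Fintype.card I) (fun i => Λ (Pi.single (e.symm i) 1)) (fun i => (e.symm i : ℝ × E d).1)
    (fun i => (e.symm i : ℝ × E d).2)
  refine ⟨0, v, ?_⟩
  rw [← hv]
  congr 1
  funext ω
  rw [Function.comp_apply]
  conv_lhs => rw [pi_eq_sum_univ' (I.restrict (fun p : ℝ × E d => X p.1 p.2 ω))]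
  rw [map_sum, ← e.symm.sum_comp]
  refine Finset.sum_congr rfl fun i _ => ?_
  rw [map_smul, smul_eq_mul, mul_comm]
  congr 2

/-- modification of `X` at integer times -/
def WX (N : Set Ω) (X : ℝ → E d → Ω → ℝ) (n : ℕ) (x : E d) (ω : Ω) : ℝ :=
  if n = 0 then 0 else Nᶜ.indicator (X n x) ω

lemma field_of [IsProbabilityMeasure P] (k : E d → ℝ)
    (hk1 : ContDiff ℝ 1 k) (hk0 : k 0 = 1) (hksupp : HasCompactSupport k)
    (X : ℝ → E d → Ω → ℝ)
    (hXmeas : ∀ t x, Measurable (X t x))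
    (hXgauss : ∀ (n : ℕ) (c : Fin n → ℝ) (t : Fin n → ℝ) (x : Fin n → E d),
      ∃ v : NNReal,
        Measure.map (fun ω => ∑ i, c i * X (t i) (x i) ω) P = gaussianReal 0 v)
    (hXcent : ∀ t x, ∫ ω, X t x ω ∂P = 0)
    (hXcov : ∀ t, 0 ≤ t → ∀ x y : E d,
      ∫ ω, X t x ω * X t y ω ∂P = ∫ u in Set.Icc (1:ℝ) (Real.exp t), k (u • (x - y)) / u)
    (hXindep : ∀ s t : ℝ, 0 ≤ s → s < t →
      Indep (⨆ x : E d,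
          MeasurableSpace.comap (fun ω => X t x ω - X s x ω) inferInstance)
        (⨆ u ∈ Set.Icc (0:ℝ) s, ⨆ x : E d,
          MeasurableSpace.comap (X u x) inferInstance) P)
    (N : Set Ω) (hN : MeasurableSet N) (hN0 : P N = 0)
    (hNc : ∀ ω, ω ∉ N → Continuous fun p : ℝ × E d => X p.1 p.2 ω) :
    ∃ R L, CritField P (WX N X) (KK k) R L := by
  have hg := gauss_of hXmeas hXgauss
  have hL2 : ∀ t x, MemLp (X t x) 2 P := fun t x => (hg.hasGaussianLaw_eval (t, x)).memLp_two
  have hX0 : ∀ x, X 0 x =ᵐ[P] 0 := by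
    intro x
    have h1 := hXcov 0 le_rfl x x
    simp only [Real.exp_zero, Set.Icc_self, Measure.restrict_singleton, Real.volume_singleton, zero_smul, integral_zero_measure] at h1
    have h2 := (integral_eq_zero_iff_of_nonneg (fun ω => mul_self_nonneg (X 0 x ω)) ((hL2 0 x).integrable_mul (hL2 0 x))).1 h1
    filter_upwards [h2] with ω hω
    simpa using hω
  have hNae : ∀ᵐ ω ∂P, ω ∉ N := by rw [ae_iff]; simpa using hN0
  have hae : ∀ (n : ℕ) x, WX N X n x =ᵐ[P] X n x := by
    intro n x
    by_cases hn : n = 0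
    · subst hn
      filter_upwards [hX0 x] with ω hω
      simp [WX, hω]
    · filter_upwards [hNae] with ω hω
      simp [WX, hn, hω]
  have hcovX : ∀ (m n : ℕ), m ≤ n → ∀ x y, ∫ ω, X m x ω * X n y ω ∂P = KK k m (x - y) := by
    intro m n hmn x y
    have hmm : ∫ ω, X m x ω * X m y ω ∂P = KK k m (x - y) := hXcov m (by positivity) x y
    rcases hmn.eq_or_lt with rfl | hlt
    · exact hmm
    have hind : IndepFun (fun ω => X n y ω - X m y ω) (X m x) P := by
      have := hXindep m n (by positivity) (by exact_mod_cast hlt)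
      refine indep_of_indep_of_le_left (indep_of_indep_of_le_right this ?_) ?_
      · exact le_trans (le_iSup (fun x => MeasurableSpace.comap (X m x) inferInstance) x)
          (le_iSup₂_of_le (m:ℝ) ⟨by positivity, le_rfl⟩ le_rfl)
      · exact le_iSup (fun y => MeasurableSpace.comap (fun ω => X n y ω - X m y ω) inferInstance) y
    have hz := hind.integral_fun_mul_eq_mul_integral ((hXmeas _ _).sub (hXmeas _ _)).aestronglyMeasurable
      (hXmeas _ _).aestronglyMeasurable
    rw [hXcent, mul_zero] at hz
    have e : ∀ ω, X m x ω * X n y ω = X m x ω * X m y ω + (X n y ω - X m y ω) * X m x ω := fun ω => by ring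
    simp_rw [e]
    have hi1 : Integrable (fun ω => X m x ω * X m y ω) P := (hL2 _ _).integrable_mul (hL2 _ _)
    have hi2 : Integrable (fun ω => (X n y ω - X m y ω) * X m x ω) P :=
      ((hL2 _ _).sub (hL2 _ _)).integrable_mul (hL2 _ _)
    rw [integral_add hi1 hi2, hz, hmm, add_zero]
  obtain ⟨R0, hR0⟩ := hksupp.isCompact.isBounded.subset_closedBall (0 : E d)
  set R := max (R0 + 1) 2 with hR
  have hRk : ∀ z, R ≤ ‖z‖ → k z = 0 := by
    intro z hz
    apply image_eq_zero_of_notMem_tsupport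
    intro hmem
    have := hR0 hmem
    rw [mem_closedBall_zero_iff] at this
    have := le_max_left (R0 + 1) 2
    linarith
  obtain ⟨L, hL⟩ := ContDiff.lipschitzWith_of_hasCompactSupport hksupp hk1 (by simp)
  refine ⟨R, L, ?_⟩
  constructor
  · intro n x
    unfold WX
    split_ifs
    · exact measurable_const
    · exact (hXmeas _ _).indicator hN.compl
  · intro n ω
    unfold WX
    split_ifs
    · exact continuous_const
    · by_cases hω : ω ∈ N
      · simp only [Set.indicator, Set.mem_compl_iff, hω, not_true_eq_false, if_false]
        exact continuous_const
      · simp only [Set.indicator, Set.mem_compl_iff, hω, not_false_eq_true, if_true]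
        exact (hNc ω hω).comp (continuous_const.prodMk continuous_id)
  · have := hg.comp_right (fun p : ℕ × E d => ((p.1 : ℝ), p.2))
    exact this.congr fun p => (hae p.1 p.2).symm
  · intro n x
    rw [integral_congr_ae (hae n x), hXcent]
  · intro m n x y
    have h1 : (fun ω => WX N X m x ω * WX N X n y ω) =ᵐ[P] fun ω => X m x ω * X n y ω := (hae m x).mul (hae n y)
    rw [integral_congr_ae h1]
    rcases le_total m n with hmn | hmn
    · rw [min_eq_left hmn, hcovX m n hmn]
    · rw [min_eq_right hmn]
      simp_rw [mul_comm (X m x _)]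
      rw [hcovX n m hmn]
      have h2 := hXcov n (by positivity) y x
      have h3 := hXcov n (by positivity) x y
      simp_rw [mul_comm (X n y _)] at h2
      change _ = KK k n (y - x) at h2
      change _ = KK k n (x - y) at h3
      rw [← h2, h3]
  · intro x ω; simp [WX]
  · exact KK_zero hk0
  · intro m n z hmn hz
    exact KK_sep (by positivity) hRk m n z hmn hz
  · exact KK_close hk0 hL
  · exact le_max_right _ _
  · exact L.2

end DerivMeas


theorem derivative_measure_negative_moments
    {d : ℕ} (hd : 1 ≤ d)
    {Ω : Type*} [m0 : MeasurableSpace Ω] (P : Measure Ω) [IsProbabilityMeasure P]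
    (k : EuclideanSpace ℝ (Fin d) → ℝ)
    (hk1 : ContDiff ℝ 1 k) (hk0 : k 0 = 1) (hkb : ∀ z, |k z| ≤ 1)
    (hksupp : HasCompactSupport k)
    (hkpd : ∀ (n : ℕ) (z : Fin n → EuclideanSpace ℝ (Fin d)) (c : Fin n → ℝ),
      0 ≤ ∑ i, ∑ j, c i * c j * k (z i - z j))
    (X : ℝ → EuclideanSpace ℝ (Fin d) → Ω → ℝ)
    (hXmeas : ∀ t x, Measurable (X t x))
    (hXgauss : ∀ (n : ℕ) (c : Fin n → ℝ) (t : Fin n → ℝ)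
        (x : Fin n → EuclideanSpace ℝ (Fin d)),
      ∃ v : NNReal,
        Measure.map (fun ω => ∑ i, c i * X (t i) (x i) ω) P = gaussianReal 0 v)
    (hXcent : ∀ t x, ∫ ω, X t x ω ∂P = 0)
    (hXcov : ∀ t, 0 ≤ t → ∀ x y : EuclideanSpace ℝ (Fin d),
      ∫ ω, X t x ω * X t y ω ∂P = ∫ u in Set.Icc (1:ℝ) (Real.exp t), k (u • (x - y)) / u)
    (hXcont : ∀ᵐ ω ∂P, Continuous fun p : ℝ × EuclideanSpace ℝ (Fin d) => X p.1 p.2 ω)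
    (hXindep : ∀ s t : ℝ, 0 ≤ s → s < t →
      Indep (⨆ x : EuclideanSpace ℝ (Fin d),
          MeasurableSpace.comap (fun ω => X t x ω - X s x ω) inferInstance)
        (⨆ u ∈ Set.Icc (0:ℝ) s, ⨆ x : EuclideanSpace ℝ (Fin d),
          MeasurableSpace.comap (X u x) inferInstance) P)
    :
    ∀ A : Set (EuclideanSpace ℝ (Fin d)), A.Nonempty → IsOpen A → Bornology.IsBounded A →
    ∀ M' : Ω → ℝ,
      (∀ᵐ ω ∂P, Tendsto (fun t : ℝ =>
          ∫ x in A, (Real.sqrt (2 * (d:ℝ)) * t - X t x ω) *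
            Real.exp (Real.sqrt (2 * (d:ℝ)) * X t x ω - (d:ℝ) * t))
        atTop (nhds (M' ω))) →
      (∀ᵐ ω ∂P, 0 < M' ω) ∧
      ∀ q : ℝ, 0 < q → ∫⁻ ω, ENNReal.ofReal (M' ω ^ (-q)) ∂P < ⊤ := by
  intro A hAn hAo hAb M' hM
  set N := toMeasurable P {ω | ¬ Continuous fun p : ℝ × EuclideanSpace ℝ (Fin d) => X p.1 p.2 ω} with hN
  have hN0 : P N = 0 := by rw [hN, measure_toMeasurable]; exact hXcont
  have hNc : ∀ ω, ω ∉ N → Continuous fun p : ℝ × EuclideanSpace ℝ (Fin d) => X p.1 p.2 ω := by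
    intro ω hω
    by_contra hc
    exact hω (subset_toMeasurable _ _ hc)
  have hNae : ∀ᵐ ω ∂P, ω ∉ N := by rw [ae_iff]; simpa using hN0
  obtain ⟨R, L, h⟩ := DerivMeas.field_of k hk1 hk0 hksupp X hXmeas hXgauss hXcent hXcov hXindep N
    (measurableSet_toMeasurable _ _) hN0 hNc
  have hdpos : (0:ℝ) < d := by exact_mod_cast hd
  have hγ : 0 < Real.sqrt (2 * (d:ℝ)) := Real.sqrt_pos.2 (by positivity)
  have hγd : Real.sqrt (2 * (d:ℝ)) ^ 2 = 2 * d := Real.sq_sqrt (by positivity)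
  have hM2 : ∀ᵐ ω ∂P, Tendsto (fun n => DerivMeas.Dn (Real.sqrt (2 * (d:ℝ))) (DerivMeas.WX N X) n A ω) atTop
      (nhds (M' ω)) := by
    filter_upwards [hM, hNae] with ω hω hωN
    refine (hω.comp tendsto_natCast_atTop_atTop).congr' ?_
    filter_upwards [eventually_gt_atTop 0] with n hn
    have e : ∀ x, DerivMeas.WX N X n x ω = X n x ω := fun x => by
      simp [DerivMeas.WX, hn.ne', hωN]
    simp only [Function.comp_apply, DerivMeas.Dn, e, hγd]
    congr 1
    funext x
    rw [mul_div_cancel_left₀ (d:ℝ) two_ne_zero]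
  exact ⟨(DerivMeas.main_field hd h hγ hγd hAb hAo hAn hM2 one_pos).1,
    fun q hq => (DerivMeas.main_field hd h hγ hγd hAb hAo hAn hM2 hq).2⟩
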